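/- arXiv:2403.05737 — 3 statements merged into one kernel-verified Lean document; each statement's English description precedes it below -/
import Mathlib

section
/- A hereditary class F of finite simple graphs is degree-bounded if and only if there exists a natural number c such that every bipartite graph H ∈ F that has no (not necessarily induced) subgraph isomorphic to the 4-cycle C₄ satisfies δ(H) ≤ c. -/
open SimpleGraph
open scoped Classical

noncomputable section

/-- Minimum degree of a finite simple graph. -/
def minDeg {V : Type} [Fintype V] (G : SimpleGraph V) : ℕ :=
  G.minDegree

/-- `G` contains `K_{t,t}` as a (not necessarily induced) subgraph. -/
def HasBicliqueSub {V : Type} (G : SimpleGraph V) (t : ℕ) : Prop :=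
  ∃ A B : Finset V, Disjoint A B ∧ A.card = t ∧ B.card = t ∧
    ∀ a ∈ A, ∀ b ∈ B, G.Adj a b

/-- The biclique number of `G`. -/
def bicliqueNum {V : Type} [Fintype V] (G : SimpleGraph V) : ℕ :=
  sSup {t | HasBicliqueSub G t}

/-- A class of finite simple graphs. -/
def GraphClass := ∀ (V : Type) [Fintype V], SimpleGraph V → Prop

/-- Hereditary: closed under isomorphism and nonempty induced subgraphs. -/
def Hereditary (F : GraphClass) : Prop :=
  (∀ (V W : Type) [Fintype V] [Fintype W] (G : SimpleGraph V) (H : SimpleGraph W),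
      Nonempty (G ≃g H) → F V G → F W H) ∧
  (∀ (V : Type) [Fintype V] (G : SimpleGraph V) (s : Set V), s.Nonempty →
      F V G → F s (G.induce s))

/-- `G` is bipartite: the vertices can be partitioned into two independent sets. -/
def Bip {V : Type} (G : SimpleGraph V) : Prop :=
  ∃ A : Set V, ∀ ⦃a b : V⦄, G.Adj a b → (a ∈ A ↔ b ∉ A)

/-- `G` contains `H` as a (not necessarily induced) subgraph. -/
def ContainsSub {V W : Type} (H : SimpleGraph V) (G : SimpleGraph W) : Prop :=
  ∃ f : V → W, Function.Injective f ∧ ∀ ⦃a b : V⦄, H.Adj a b → G.Adj (f a) (f b)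

/-- The 4-cycle. -/
def C4 : SimpleGraph (Fin 4) := SimpleGraph.fromRel fun i j => j = i + 1

/-- Greedy independent sets for a bounded-degree symmetric relation. -/
theorem greedy_indep {α : Type} (R : α → α → Prop) (hR : ∀ x y, R x y → R y x) (Δ : ℕ) :
    ∀ (n : ℕ) (S : Finset α), S.card ≤ n → (∀ x ∈ S, (S.filter (R x)).card ≤ Δ) →
    ∃ I ⊆ S, (∀ x ∈ I, ∀ y ∈ I, x ≠ y → ¬ R x y) ∧ S.card ≤ I.card * (Δ + 1) := by
  intro n
  induction n with
  | zero =>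
    intro S hS _
    exact ⟨∅, by simp, by simp, by simpa using hS⟩
  | succ n ih =>
    intro S hS hd
    rcases S.eq_empty_or_nonempty with rfl | ⟨v, hv⟩
    · exact ⟨∅, by simp, by simp, by simp⟩
    set S' := S.filter (fun x => x ≠ v ∧ ¬ R v x) with hS'
    have hsub : S' ⊆ S := Finset.filter_subset _ _
    have hvS' : v ∉ S' := by simp [hS']
    have hlt : S'.card < S.card := Finset.card_lt_card ⟨hsub, fun h => hvS' (h hv)⟩
    obtain ⟨I, hIS, hI, hc⟩ := ih S' (by omega) (fun x hx =>
      (Finset.card_le_card (Finset.filter_subset_filter _ hsub)).trans (hd x (hsub hx)))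
    refine ⟨insert v I, ?_, ?_, ?_⟩
    · intro x hx
      rcases Finset.mem_insert.1 hx with rfl | hx
      · exact hv
      · exact hsub (hIS hx)
    · intro x hx y hy hxy
      rcases Finset.mem_insert.1 hx with hx1 | hx1 <;>
        rcases Finset.mem_insert.1 hy with hy1 | hy1
      · exact absurd (hx1.trans hy1.symm) hxy
      · subst hx1
        have := hIS hy1
        simp only [hS', Finset.mem_filter] at this
        exact this.2.2
      · subst hy1
        have := hIS hx1
        simp only [hS', Finset.mem_filter] at this
        exact fun h => this.2.2 (hR _ _ h)
      · exact hI x hx1 y hy1 hxy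
    · have hvI : v ∉ I := fun h => hvS' (hIS h)
      rw [Finset.card_insert_of_notMem hvI]
      have h1 : S ⊆ S' ∪ (insert v (S.filter (R v))) := by
        intro x hx
        simp only [hS', Finset.mem_union, Finset.mem_filter, Finset.mem_insert]
        tauto
      have h2 := (Finset.card_le_card h1).trans (Finset.card_union_le _ _)
      have h3 := Finset.card_insert_le v (S.filter (R v))
      have h4 := hd v hv
      nlinarith

/-- Independence of a finset of vertices. -/
def Indep {V : Type} (G : SimpleGraph V) (I : Finset V) : Prop :=
  ∀ x ∈ I, ∀ y ∈ I, ¬ G.Adj x y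

/-- No clique with `q` vertices inside `X`. -/
def NoClq {V : Type} (G : SimpleGraph V) (q : ℕ) (X : Finset V) : Prop :=
  ∀ Q ⊆ X, Q.card = q → ¬ ∀ x ∈ Q, ∀ y ∈ Q, x ≠ y → G.Adj x y

theorem NoClq.mono {V : Type} {G : SimpleGraph V} {q : ℕ} {X Y : Finset V} (h : NoClq G q X)
    (hY : Y ⊆ X) : NoClq G q Y := fun Q hQ => h Q (hQ.trans hY)

theorem Indep.mono {V : Type} {G : SimpleGraph V} {X Y : Finset V} (h : Indep G X)
    (hY : Y ⊆ X) : Indep G Y := fun x hx y hy => h x (hY hx) y (hY hy)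

theorem ramsey_poly {V : Type} (G : SimpleGraph V) (α : ℕ) : ∀ (q : ℕ) (X : Finset V),
    NoClq G q X → (∀ I ⊆ X, Indep G I → I.card ≤ α) → X.card ≤ (α + 1) ^ (q + 1) := by
  intro q
  induction q with
  | zero =>
    intro X h _
    exact absurd (by simp) (h ∅ (by simp) rfl)
  | succ q ih =>
    intro X h hα
    have key : ∀ x ∈ X, (X.filter (G.Adj x)).card ≤ (α + 1) ^ (q + 1) := by
      intro x hx
      apply ih
      · intro Q hQ hc hcl
        have hxQ : x ∉ Q := by
          intro hxq
          have := hQ hxq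
          simp at this
        refine h (insert x Q) ?_ ?_ ?_
        · intro y hy
          rcases Finset.mem_insert.1 hy with rfl | hy
          · exact hx
          · exact (Finset.mem_filter.1 (hQ hy)).1
        · rw [Finset.card_insert_of_notMem hxQ, hc]
        · intro a ha b hb hab
          rcases Finset.mem_insert.1 ha with ha1 | ha1 <;>
            rcases Finset.mem_insert.1 hb with hb1 | hb1
          · exact absurd (ha1.trans hb1.symm) hab
          · rw [ha1]
            exact (Finset.mem_filter.1 (hQ hb1)).2
          · rw [hb1]
            exact ((Finset.mem_filter.1 (hQ ha1)).2).symm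
          · exact hcl a ha1 b hb1 hab
      · intro I hI hI'
        exact hα I (hI.trans (Finset.filter_subset _ _)) hI'
    obtain ⟨I, hIX, hI, hc⟩ := greedy_indep G.Adj (fun _ _ h => h.symm) _ X.card X le_rfl key
    have hIα : I.card ≤ α := hα I hIX (by
      intro x hx y hy hxy
      exact hI x hx y hy hxy.ne hxy)
    calc X.card ≤ I.card * ((α + 1) ^ (q + 1) + 1) := hc
      _ ≤ α * ((α + 1) ^ (q + 1) + 1) := by gcongr
      _ ≤ (α + 1) ^ (q + 1 + 1) := by
        have : α + 1 ≤ (α + 1) ^ (q + 1) := Nat.le_self_pow (by omega) _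
        rw [pow_succ (α + 1) (q + 1)]
        nlinarith

/-- Independent subsets of `X`. -/
def indSets {V : Type} (G : SimpleGraph V) (X : Finset V) : Finset (Finset V) :=
  X.powerset.filter (Indep G)

theorem mem_indSets {V : Type} {G : SimpleGraph V} {X Y : Finset V} :
    Y ∈ indSets G X ↔ Y ⊆ X ∧ Indep G Y := by
  simp [indSets]

theorem small_subsets_card {V : Type} (X : Finset V) (j : ℕ) :
    (X.powerset.filter (fun Y => Y.card < j)).card ≤ j * (X.card + 1) ^ j := by
  have h : X.powerset.filter (fun Y => Y.card < j) ⊆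
      (Finset.range j).biUnion (fun i => X.powersetCard i) := by
    intro Y hY
    simp only [Finset.mem_filter, Finset.mem_powerset] at hY
    simp only [Finset.mem_biUnion, Finset.mem_range, Finset.mem_powersetCard]
    exact ⟨Y.card, hY.2, hY.1, rfl⟩
  refine (Finset.card_le_card h).trans (Finset.card_biUnion_le.trans ?_)
  calc ∑ i ∈ Finset.range j, (X.powersetCard i).card
      ≤ ∑ i ∈ Finset.range j, (X.card + 1) ^ j := by
        apply Finset.sum_le_sum
        intro i hi
        rw [Finset.card_powersetCard]
        calc X.card.choose i ≤ X.card ^ i := Nat.choose_le_pow _ _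
          _ ≤ (X.card + 1) ^ i := Nat.pow_le_pow_left (by omega) _
          _ ≤ (X.card + 1) ^ j := Nat.pow_le_pow_right (by omega) (Finset.mem_range.1 hi).le
    _ = _ := by simp

theorem exp_beats (c e : ℕ) : ∃ a0 : ℕ, ∀ a ≥ a0, c * (a + 2) ^ e ≤ 2 ^ a := by
  have h := tendsto_pow_const_div_const_pow_of_one_lt e (r := (2:ℝ)) (by norm_num)
  have h2 := h.eventually (gt_mem_nhds (show (0:ℝ) < 1 / (4 * (c + 1)) by positivity))
  obtain ⟨a0, ha⟩ := Filter.eventually_atTop.1 h2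
  refine ⟨a0, fun a haa => ?_⟩
  have h3 := ha (a + 2) (by omega)
  rw [div_lt_div_iff₀ (by positivity) (by positivity)] at h3
  have h4 : ((c * (a + 2) ^ e : ℕ) : ℝ) ≤ ((2 ^ a : ℕ) : ℝ) := by
    push_cast at h3 ⊢
    have h5 : (0:ℝ) ≤ ((a:ℝ) + 2) ^ e := by positivity
    rw [pow_add] at h3
    nlinarith
  exact_mod_cast h4

theorem avg_ind_size (q m : ℕ) : ∃ x0 : ℕ, ∀ (V : Type) (G : SimpleGraph V) (X : Finset V),
    NoClq G q X → x0 ≤ (indSets G X).card →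
    m * (indSets G X).card ≤ ∑ Y ∈ indSets G X, Y.card := by
  obtain ⟨a0, ha0⟩ := exp_beats (2 * (2 * m)) ((q + 1) * (2 * m))
  refine ⟨2 ^ ((a0 + 1) ^ (q + 1)) + 1, fun V G X hX hcard => ?_⟩
  -- a maximum independent set
  obtain ⟨I, hI, hmax⟩ := (indSets G X).exists_max_image Finset.card
    ⟨∅, mem_indSets.2 ⟨by simp, by intro x hx; simp at hx⟩⟩
  rw [mem_indSets] at hI
  have hram := ramsey_poly G I.card q X hX (fun J hJ hJ' => hmax J (mem_indSets.2 ⟨hJ, hJ'⟩))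
  have hIa : a0 ≤ I.card := by
    by_contra hlt
    push Not at hlt
    have h1 : (indSets G X).card ≤ 2 ^ X.card := by
      rw [← Finset.card_powerset]
      exact Finset.card_le_card (Finset.filter_subset _ _)
    have h2 : X.card ≤ (a0 + 1) ^ (q + 1) := hram.trans (Nat.pow_le_pow_left (by omega) _)
    have h3 : 2 ^ X.card ≤ 2 ^ ((a0 + 1) ^ (q + 1)) := Nat.pow_le_pow_right (by norm_num) h2
    omega
  have hlow : 2 ^ I.card ≤ (indSets G X).card := by
    rw [← Finset.card_powerset]
    apply Finset.card_le_card
    intro Y hY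
    rw [Finset.mem_powerset] at hY
    exact mem_indSets.2 ⟨hY.trans hI.1, hI.2.mono hY⟩
  set P := indSets G X with hP
  have hsmall : 2 * (P.filter (fun Y => Y.card < 2 * m)).card ≤ P.card := by
    have h1 : (P.filter (fun Y => Y.card < 2 * m)).card ≤ 2 * m * (X.card + 1) ^ (2 * m) := by
      refine (Finset.card_le_card ?_).trans (small_subsets_card X (2 * m))
      apply Finset.filter_subset_filter
      exact Finset.filter_subset _ _
    have h2 : X.card + 1 ≤ (I.card + 2) ^ (q + 1) := by
      have : (I.card + 1) ^ (q + 1) < (I.card + 2) ^ (q + 1) :=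
        Nat.pow_lt_pow_left (by omega) (by omega)
      omega
    have h3 : (X.card + 1) ^ (2 * m) ≤ (I.card + 2) ^ ((q + 1) * (2 * m)) := by
      rw [pow_mul (I.card + 2)]
      exact Nat.pow_le_pow_left h2 _
    have h4 := ha0 I.card hIa
    have h5 : 2 * m * (X.card + 1) ^ (2 * m) ≤ 2 * m * (I.card + 2) ^ ((q + 1) * (2 * m)) :=
      Nat.mul_le_mul_left _ h3
    have h6 : 2 * (2 * m) * (I.card + 2) ^ ((q + 1) * (2 * m)) =
      2 * (2 * m * (I.card + 2) ^ ((q + 1) * (2 * m))) := by ring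
    omega
  have hsplit := Finset.card_filter_add_card_filter_not (s := P) (fun Y => Y.card < 2 * m)
  have hbig : (P.filter (fun Y => ¬ Y.card < 2 * m)).card * (2 * m) ≤ ∑ Y ∈ P, Y.card := by
    calc _ ≤ ∑ Y ∈ P.filter (fun Y => ¬ Y.card < 2 * m), Y.card := by
          rw [← smul_eq_mul]
          apply Finset.card_nsmul_le_sum
          intro Y hY
          have := (Finset.mem_filter.1 hY).2
          omega
      _ ≤ _ := Finset.sum_le_sum_of_subset (Finset.filter_subset _ _)
  refine le_trans ?_ hbig
  have : P.card ≤ 2 * (P.filter (fun Y => ¬ Y.card < 2 * m)).card := by omega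
  nlinarith

/-- One-vertex local estimate for a uniformly random independent set. -/
theorem local_occupancy (q m : ℕ) : ∃ Δ0 : ℕ, ∀ Δ ≥ Δ0, ∀ (V : Type) (G : SimpleGraph V)
    (S : Finset V), NoClq G q S → ∀ v ∈ S,
    m * (indSets G S).card ≤
      ∑ W ∈ indSets G S, ((if v ∈ W then Δ else 0) + (W.filter (G.Adj v)).card) := by
  obtain ⟨x0, hx0⟩ := avg_ind_size q (2 * m)
  refine ⟨m * (1 + x0), fun Δ hΔ V G S hS v hv => ?_⟩
  set N := insert v (S.filter (G.Adj v)) with hN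
  set P := indSets G S with hP
  set T := P.image (fun W => W \ N) with hT
  have hmaps : ∀ W ∈ P, W \ N ∈ T := fun W hW => Finset.mem_image_of_mem _ hW
  rw [Finset.card_eq_sum_card_fiberwise hmaps, ← Finset.sum_fiberwise_of_maps_to hmaps,
    Finset.mul_sum]
  apply Finset.sum_le_sum
  intro H hH
  obtain ⟨W0, hW0, hW0H⟩ := Finset.mem_image.1 hH
  have hW0' := mem_indSets.1 hW0
  have hHS : H ⊆ S := by
    rw [← hW0H]
    exact Finset.sdiff_subset.trans hW0'.1
  have hHind : Indep G H := by
    rw [← hW0H]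
    exact hW0'.2.mono Finset.sdiff_subset
  have hHN : ∀ x ∈ H, x ≠ v ∧ ¬ G.Adj v x := by
    intro x hx
    rw [← hW0H] at hx
    simp only [hN, Finset.mem_sdiff, Finset.mem_insert, Finset.mem_filter, not_or, not_and] at hx
    exact ⟨hx.2.1, hx.2.2 (hW0'.1 hx.1)⟩
  set X := S.filter (fun u => G.Adj v u ∧ ∀ h ∈ H, ¬ G.Adj u h) with hX
  have hXS : X ⊆ S := Finset.filter_subset _ _
  have hXH : ∀ Y ⊆ X, Disjoint H Y := by
    intro Y hY
    rw [Finset.disjoint_left]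
    intro x hx hxY
    have := hY hxY
    simp only [hX, Finset.mem_filter] at this
    exact (hHN x hx).2 this.2.1
  -- the fibre
  have hfib : P.filter (fun W => W \ N = H) =
      insert (insert v H) ((indSets G X).image (fun Y => H ∪ Y)) := by
    ext W
    simp only [Finset.mem_filter, Finset.mem_insert, Finset.mem_image, hP, mem_indSets]
    constructor
    · rintro ⟨⟨hWS, hWi⟩, hWH⟩
      by_cases hvW : v ∈ W
      · left
        ext x
        rw [← hWH]
        simp only [Finset.mem_insert, Finset.mem_sdiff, hN, Finset.mem_filter]
        constructor
        · intro hx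
          by_cases hxv : x = v
          · exact Or.inl hxv
          · refine Or.inr ⟨hx, ?_⟩
            rintro (h | h)
            · exact hxv h
            · exact hWi v hvW x hx h.2
        · rintro (h | h)
          · rw [h]
            exact hvW
          · exact h.1
      · right
        refine ⟨W ∩ N, ⟨?_, hWi.mono Finset.inter_subset_left⟩, ?_⟩
        · intro x hx
          rw [Finset.mem_inter] at hx
          have h2 := hx.2
          simp only [hN, Finset.mem_insert, Finset.mem_filter] at h2
          rcases h2 with h2 | h2
          · exact absurd (h2 ▸ hx.1) hvW
          · simp only [hX, Finset.mem_filter]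
            refine ⟨h2.1, h2.2, fun h hh => ?_⟩
            rw [← hWH] at hh
            exact hWi x hx.1 h (Finset.mem_sdiff.1 hh).1
        · rw [← hWH]
          exact Finset.sdiff_union_inter W N
    · rintro (rfl | ⟨Y, ⟨hYX, hYi⟩, rfl⟩)
      · refine ⟨⟨?_, ?_⟩, ?_⟩
        · intro x hx
          rcases Finset.mem_insert.1 hx with h | h
          · exact h ▸ hv
          · exact hHS h
        · intro x hx y hy hxy
          rcases Finset.mem_insert.1 hx with hx1 | hx1 <;>
            rcases Finset.mem_insert.1 hy with hy1 | hy1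
          · exact hxy.ne (hx1.trans hy1.symm)
          · exact (hHN y hy1).2 (hx1 ▸ hxy)
          · exact (hHN x hx1).2 (hy1 ▸ hxy.symm)
          · exact hHind x hx1 y hy1 hxy
        · ext x
          simp only [Finset.mem_sdiff, Finset.mem_insert, hN, Finset.mem_filter]
          constructor
          · tauto
          · intro hx
            have := hHN x hx
            tauto
      · have hY : ∀ y ∈ Y, y ∈ S ∧ G.Adj v y ∧ ∀ h ∈ H, ¬ G.Adj y h := by
          intro y hy
          have := hYX hy
          simpa only [hX, Finset.mem_filter] using this
        refine ⟨⟨Finset.union_subset hHS (hYX.trans hXS), ?_⟩, ?_⟩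
        · intro x hx y hy hxy
          rcases Finset.mem_union.1 hx with hx1 | hx1 <;>
            rcases Finset.mem_union.1 hy with hy1 | hy1
          · exact hHind x hx1 y hy1 hxy
          · exact (hY y hy1).2.2 x hx1 hxy.symm
          · exact (hY x hx1).2.2 y hy1 hxy
          · exact hYi x hx1 y hy1 hxy
        · ext x
          simp only [Finset.mem_sdiff, Finset.mem_union, Finset.mem_insert, hN, Finset.mem_filter]
          constructor
          · rintro ⟨h1 | h1, h2⟩
            · exact h1
            · exact absurd (Or.inr ⟨(hY x h1).1, (hY x h1).2.1⟩) h2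
          · intro hx
            have := hHN x hx
            tauto
  have hnotin : insert v H ∉ (indSets G X).image (fun Y => H ∪ Y) := by
    intro h
    obtain ⟨Y, hY, hYe⟩ := Finset.mem_image.1 h
    have : v ∈ H ∪ Y := by
      rw [hYe]
      exact Finset.mem_insert_self _ _
    rcases Finset.mem_union.1 this with h1 | h1
    · exact (hHN v h1).1 rfl
    · have := (mem_indSets.1 hY).1 h1
      simp [hX] at this
  have hinj : Set.InjOn (fun Y => H ∪ Y) (indSets G X : Set (Finset V)) := by
    intro Y hY Z hZ hYZ
    have hY' := hXH Y (mem_indSets.1 (Finset.mem_coe.1 hY)).1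
    have hZ' := hXH Z (mem_indSets.1 (Finset.mem_coe.1 hZ)).1
    have h1 : (H ∪ Y) \ H = (H ∪ Z) \ H := by
      simp only at hYZ
      rw [hYZ]
    rwa [Finset.union_sdiff_cancel_left hY', Finset.union_sdiff_cancel_left hZ'] at h1
  rw [hfib, Finset.card_insert_of_notMem hnotin, Finset.sum_insert hnotin,
    Finset.card_image_of_injOn hinj, Finset.sum_image hinj]
  have hsum : ∑ Y ∈ indSets G X, Y.card ≤
      ∑ Y ∈ indSets G X, ((if v ∈ H ∪ Y then Δ else 0) + ((H ∪ Y).filter (G.Adj v)).card) := by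
    apply Finset.sum_le_sum
    intro Y hY
    refine le_trans (Finset.card_le_card ?_) (Nat.le_add_left _ _)
    intro y hy
    have := (mem_indSets.1 hY).1 hy
    simp only [hX, Finset.mem_filter] at this
    exact Finset.mem_filter.2 ⟨Finset.mem_union_right _ hy, this.2.1⟩
  have hvin : v ∈ insert v H := Finset.mem_insert_self _ _
  rw [if_pos hvin]
  have hpos : 1 ≤ (indSets G X).card := by
    apply Finset.card_pos.2
    exact ⟨∅, mem_indSets.2 ⟨by simp, by intro x hx; simp at hx⟩⟩
  by_cases hlarge : x0 ≤ (indSets G X).card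
  · have := hx0 V G X (hS.mono hXS) hlarge
    nlinarith
  · push Not at hlarge
    have : m * ((indSets G X).card + 1) ≤ m * (1 + x0) := Nat.mul_le_mul_left _ (by omega)
    omega

/-- Large independent sets in clique-free graphs with bounded degree. -/
theorem large_indep (q m : ℕ) : ∃ Δ0 : ℕ, ∀ Δ ≥ Δ0, ∀ (V : Type) (G : SimpleGraph V)
    (S : Finset V), NoClq G q S → (∀ v ∈ S, (S.filter (G.Adj v)).card ≤ Δ) →
    ∃ I ⊆ S, Indep G I ∧ m * S.card ≤ Δ * I.card := by
  obtain ⟨Δ0, h0⟩ := local_occupancy q (2 * m)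
  refine ⟨Δ0, fun Δ hΔ V G S hS hdeg => ?_⟩
  have hne : (indSets G S).Nonempty := ⟨∅, mem_indSets.2 ⟨by simp, by intro x hx; simp at hx⟩⟩
  have hloc : ∀ v ∈ S, _ := fun v hv => h0 Δ hΔ V G S hS v hv
  have hsum := Finset.sum_le_sum hloc
  rw [Finset.sum_comm, Finset.sum_const, smul_eq_mul] at hsum
  have hW : ∀ W ∈ indSets G S,
      ∑ v ∈ S, ((if v ∈ W then Δ else 0) + (W.filter (G.Adj v)).card) ≤ 2 * (Δ * W.card) := by
    intro W hW
    have hWS := (mem_indSets.1 hW).1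
    rw [Finset.sum_add_distrib]
    have h1 : ∑ v ∈ S, (if v ∈ W then Δ else 0) = W.card * Δ := by
      rw [← Finset.sum_filter, Finset.sum_const, smul_eq_mul]
      congr 2
      ext x
      simp only [Finset.mem_filter]
      exact ⟨fun h => h.2, fun h => ⟨hWS h, h⟩⟩
    have h2 : ∑ v ∈ S, (W.filter (G.Adj v)).card ≤ W.card * Δ := by
      have : ∑ v ∈ S, (W.filter (G.Adj v)).card = ∑ w ∈ W, (S.filter (G.Adj w)).card := by
        simp only [Finset.card_filter]
        rw [Finset.sum_comm]
        simp only [G.adj_comm]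
      rw [this, ← smul_eq_mul]
      apply Finset.sum_le_card_nsmul
      exact fun w hw => hdeg w (hWS hw)
    nlinarith
  have hsum2 := hsum.trans (Finset.sum_le_sum hW)
  by_contra hcon
  push Not at hcon
  have hlt : ∑ W ∈ indSets G S, 2 * (Δ * W.card) < ∑ W ∈ indSets G S, 2 * (m * S.card) := by
    apply Finset.sum_lt_sum_of_nonempty hne
    intro W hW
    have := hcon W (mem_indSets.1 hW).1 (mem_indSets.1 hW).2
    omega
  rw [Finset.sum_const, smul_eq_mul] at hlt
  have : S.card * (2 * m * (indSets G S).card) = (indSets G S).card * (2 * (m * S.card)) := by ring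
  omega

/-- Unbalanced bipartite lemma. -/
theorem unbalanced (k t : ℕ) : ∀ s : ℕ, ∃ d0 : ℕ, ∀ d : ℕ, ∃ M : ℕ,
    ∀ (α β : Type) (E : α → β → Prop) (A : Finset α) (B : Finset β), A.Nonempty →
    (∀ a ∈ A, d0 ≤ (B.filter (E a)).card ∧ (B.filter (E a)).card ≤ d) →
    M * B.card ≤ A.card →
    (∀ S ⊆ B, S.card = s → (A.filter (fun a => ∀ b ∈ S, E a b)).card < t) →
    ∃ A' ⊆ A, ∃ B' ⊆ B, A'.Nonempty ∧ B'.card ≤ A'.card ∧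
      (∀ a ∈ A', k ≤ (B'.filter (E a)).card) ∧
      (∀ a ∈ A', ∀ a' ∈ A', a ≠ a' → (B'.filter (fun b => E a b ∧ E a' b)).card ≤ 1) := by
  intro s
  induction s with
  | zero =>
    refine ⟨1, fun d => ⟨t, fun α β E A B hA hdeg hM hK => ?_⟩⟩
    exfalso
    obtain ⟨a, ha⟩ := hA
    have h1 := hK ∅ (by simp) rfl
    simp only [Finset.notMem_empty, false_implies, implies_true, Finset.filter_true] at h1
    have h2 := (hdeg a ha).1.trans (Finset.card_le_card (Finset.filter_subset _ _))
    nlinarith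
  | succ s ih =>
    obtain ⟨e0, ih⟩ := ih
    refine ⟨k * (e0 + 1) + 1, fun d => ?_⟩
    obtain ⟨M0, ih⟩ := ih d
    set M1 := 2 * d * d * M0 + 1 with hM1
    refine ⟨2 * 2 ^ d * (d * d * M1 + 1), fun α β E A B hA hdeg hM hK => ?_⟩
    have hd : 0 < d := by
      obtain ⟨a, ha⟩ := hA
      have := hdeg a ha
      omega
    -- codegrees
    set cod : β → β → ℕ := fun b b' => (A.filter (fun a => E a b ∧ E a b')).card with hcod
    have hcods : ∀ b b', cod b b' = cod b' b := by
      intro b b'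
      simp only [hcod, and_comm]
    obtain ⟨heavy, hheavy⟩ : ∃ heavy : β → β → Prop, ∀ b b', heavy b b' ↔
      (b ≠ b' ∧ M1 ≤ cod b b') := ⟨_, fun _ _ => Iff.rfl⟩
    have hhs : ∀ b b', heavy b b' → heavy b' b := by
      intro b b' h
      obtain ⟨h1, h2⟩ := (hheavy _ _).1 h
      exact (hheavy _ _).2 ⟨h1.symm, (hcods b b') ▸ h2⟩
    set bad : β → Finset α := fun b => A.filter (fun a => E a b ∧
      e0 ≤ ((B.filter (heavy b)).filter (E a)).card) with hbad
    by_cases hcase : ∃ b ∈ B, (bad b).Nonempty ∧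
        (A.filter (fun a => E a b)).card ≤ 2 * d * (bad b).card
    · -- use the induction hypothesis in the link of `b`
      obtain ⟨b, hb, hne, hbig⟩ := hcase
      have hBB : B.filter (heavy b) ⊆ B := Finset.filter_subset _ _
      have hAA : bad b ⊆ A := Finset.filter_subset _ _
      obtain ⟨A', hA', B', hB', h1, h2, h3, h4⟩ := ih α β E (bad b) (B.filter (heavy b)) hne
        (by
          intro a ha
          have ha' := Finset.mem_filter.1 ha
          exact ⟨ha'.2.2, (Finset.card_le_card (Finset.filter_subset_filter _ hBB)).trans
            (hdeg a ha'.1).2⟩)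
        (by
          have h1 : (B.filter (heavy b)).card * M1 ≤ ∑ b' ∈ B.filter (heavy b), cod b b' := by
            rw [← smul_eq_mul]
            apply Finset.card_nsmul_le_sum
            intro b' hb'
            exact ((hheavy _ _).1 (Finset.mem_filter.1 hb').2).2
          have h2 : ∑ b' ∈ B.filter (heavy b), cod b b' ≤
              (A.filter (fun a => E a b)).card * d := by
            calc ∑ b' ∈ B.filter (heavy b), cod b b'
                ≤ ∑ b' ∈ B, cod b b' := Finset.sum_le_sum_of_subset hBB
              _ = ∑ b' ∈ B, ((A.filter (fun a => E a b)).filter (fun a => E a b')).card := by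
                  simp only [hcod, Finset.filter_filter]
              _ = ∑ a ∈ A.filter (fun a => E a b), (B.filter (E a)).card := by
                  simp only [Finset.card_filter _ (A.filter _), Finset.card_filter _ B]
                  rw [Finset.sum_comm]
              _ ≤ _ := by
                  rw [← smul_eq_mul]
                  apply Finset.sum_le_card_nsmul
                  intro a ha
                  exact (hdeg a (Finset.mem_filter.1 ha).1).2
          have h3 : (2 * d * d) * (M0 * (B.filter (heavy b)).card) ≤
              (2 * d * d) * (bad b).card := by
            calc (2 * d * d) * (M0 * (B.filter (heavy b)).card)
                ≤ (B.filter (heavy b)).card * M1 := by rw [hM1]; nlinarith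
              _ ≤ (A.filter (fun a => E a b)).card * d := h1.trans h2
              _ ≤ (2 * d * (bad b).card) * d := Nat.mul_le_mul_right _ hbig
              _ = _ := by ring
          exact Nat.le_of_mul_le_mul_left h3 (by positivity))
        (by
          intro S hS hSc
          have hbS : b ∉ S := by
            intro h
            have := ((hheavy _ _).1 (Finset.mem_filter.1 (hS h)).2).1
            exact this rfl
          refine lt_of_le_of_lt (Finset.card_le_card ?_) (hK (insert b S) ?_ ?_)
          · intro a ha
            have ha' := Finset.mem_filter.1 ha
            have ha'' := Finset.mem_filter.1 ha'.1
            refine Finset.mem_filter.2 ⟨ha''.1, ?_⟩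
            intro b' hb'
            rcases Finset.mem_insert.1 hb' with h | h
            · exact h ▸ ha''.2.1
            · exact ha'.2 b' h
          · intro x hx
            rcases Finset.mem_insert.1 hx with h | h
            · exact h ▸ hb
            · exact hBB (hS h)
          · rw [Finset.card_insert_of_notMem hbS, hSc])
      exact ⟨A', hA'.trans hAA, B', hB'.trans hBB, h1, h2, h3, h4⟩
    · push Not at hcase
      have hbadle : ∀ b ∈ B, 2 * d * (bad b).card ≤ (A.filter (fun a => E a b)).card := by
        intro b hb
        rcases (bad b).eq_empty_or_nonempty with h | h
        · simp [h]
        · exact (hcase b hb h).le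
      set Ab := B.biUnion bad with hAb
      have hAbc : 2 * Ab.card ≤ A.card := by
        have h1 : Ab.card ≤ ∑ b ∈ B, (bad b).card := Finset.card_biUnion_le
        have h2 : ∑ b ∈ B, 2 * d * (bad b).card ≤ ∑ b ∈ B, (A.filter (fun a => E a b)).card :=
          Finset.sum_le_sum hbadle
        have h3 : ∑ b ∈ B, (A.filter (fun a => E a b)).card = ∑ a ∈ A, (B.filter (E a)).card := by
          simp only [Finset.card_filter]
          rw [Finset.sum_comm]
        have h4 : ∑ a ∈ A, (B.filter (E a)).card ≤ A.card * d := by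
          rw [← smul_eq_mul]
          exact Finset.sum_le_card_nsmul _ _ _ (fun a ha => (hdeg a ha).2)
        rw [← Finset.mul_sum] at h2
        have h5 : d * (2 * Ab.card) ≤ d * A.card := by nlinarith
        exact Nat.le_of_mul_le_mul_left h5 hd
      set Ag := A \ Ab with hAg
      have hAgc : A.card ≤ 2 * Ag.card := by
        have h1 : A ⊆ Ag ∪ Ab := by
          intro x hx
          simp only [hAg, Finset.mem_union, Finset.mem_sdiff]
          tauto
        have := (Finset.card_le_card h1).trans (Finset.card_union_le _ _)
        omega
      -- choose non-heavy subsets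
      have hI : ∀ a ∈ Ag, ∃ I ⊆ B.filter (E a), k ≤ I.card ∧
          ∀ x ∈ I, ∀ y ∈ I, x ≠ y → ¬ heavy x y := by
        intro a ha
        have ha' := Finset.mem_sdiff.1 ha
        obtain ⟨I, hI1, hI2, hI3⟩ := greedy_indep heavy hhs e0 (B.filter (E a)).card
          (B.filter (E a)) le_rfl (by
            intro b hb
            have hb' := Finset.mem_filter.1 hb
            by_contra hlt
            push Not at hlt
            apply ha'.2
            refine Finset.mem_biUnion.2 ⟨b, hb'.1, Finset.mem_filter.2 ⟨ha'.1, hb'.2, ?_⟩⟩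
            rw [Finset.filter_filter] at hlt ⊢
            refine hlt.le.trans (Finset.card_le_card ?_)
            intro x hx
            have hx' := Finset.mem_filter.1 hx
            exact Finset.mem_filter.2 ⟨hx'.1, hx'.2.2, hx'.2.1⟩)
        refine ⟨I, hI1, ?_, hI2⟩
        have h1 := (hdeg a ha'.1).1
        by_contra hlt
        push Not at hlt
        have : I.card * (e0 + 1) ≤ k * (e0 + 1) := Nat.mul_le_mul_right _ hlt.le
        omega
      choose! I hI1 hI2 hI3 using hI
      -- averaging over subsets of `B`
      have hcount : ∀ a ∈ Ag, 2 ^ B.card ≤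
          2 ^ d * (B.powerset.filter (fun B' => B'.filter (E a) = I a)).card := by
        intro a ha
        have ha' := Finset.mem_sdiff.1 ha
        have h1 : (B \ B.filter (E a)).powerset.card ≤
            (B.powerset.filter (fun B' => B'.filter (E a) = I a)).card := by
          apply Finset.card_le_card_of_injOn (fun Y => I a ∪ Y)
          · intro Y hY
            have hY' := Finset.mem_powerset.1 (Finset.mem_coe.1 hY)
            refine Finset.mem_coe.2 (Finset.mem_filter.2 ⟨Finset.mem_powerset.2 ?_, ?_⟩)
            · exact Finset.union_subset ((hI1 a ha).trans (Finset.filter_subset _ _))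
                (hY'.trans Finset.sdiff_subset)
            · ext x
              simp only [Finset.mem_filter, Finset.mem_union]
              constructor
              · rintro ⟨h | h, h2⟩
                · exact h
                · have := Finset.mem_sdiff.1 (hY' h)
                  exact absurd (Finset.mem_filter.2 ⟨this.1, h2⟩) this.2
              · intro h
                exact ⟨Or.inl h, (Finset.mem_filter.1 (hI1 a ha h)).2⟩
          · intro Y hY Z hZ hYZ
            have hd1 : ∀ Y ∈ (B \ B.filter (E a)).powerset, Disjoint (I a) Y := by
              intro Y hY
              rw [Finset.disjoint_left]
              intro x hx hxY
              exact (Finset.mem_sdiff.1 (Finset.mem_powerset.1 hY hxY)).2 (hI1 a ha hx)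
            have h1 : (I a ∪ Y) \ I a = (I a ∪ Z) \ I a := by
              simp only at hYZ
              rw [hYZ]
            rwa [Finset.union_sdiff_cancel_left (hd1 Y hY),
              Finset.union_sdiff_cancel_left (hd1 Z hZ)] at h1
        rw [Finset.card_powerset, Finset.card_sdiff_of_subset (Finset.filter_subset _ _)] at h1
        calc 2 ^ B.card ≤ 2 ^ (d + (B.card - (B.filter (E a)).card)) := by
              apply Nat.pow_le_pow_right (by norm_num)
              have := (hdeg a ha'.1).2
              omega
          _ = 2 ^ d * 2 ^ (B.card - (B.filter (E a)).card) := pow_add _ _ _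
          _ ≤ _ := Nat.mul_le_mul_left _ h1
      have hex : ∃ B' ∈ B.powerset,
          Ag.card ≤ 2 ^ d * (Ag.filter (fun a => B'.filter (E a) = I a)).card := by
        have h1 := Finset.sum_le_sum hcount
        rw [← Finset.mul_sum, Finset.sum_const, smul_eq_mul] at h1
        have h2 : ∑ a ∈ Ag, (B.powerset.filter (fun B' => B'.filter (E a) = I a)).card =
            ∑ B' ∈ B.powerset, (Ag.filter (fun a => B'.filter (E a) = I a)).card := by
          simp only [Finset.card_filter _ B.powerset, Finset.card_filter _ Ag]
          rw [Finset.sum_comm]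
        rw [h2] at h1
        by_contra hcon
        push Not at hcon
        have h3 := Finset.sum_lt_sum_of_nonempty (s := B.powerset) ⟨∅, by simp⟩ hcon
        rw [← Finset.mul_sum, Finset.sum_const, smul_eq_mul, Finset.card_powerset] at h3
        have : Ag.card * 2 ^ B.card = 2 ^ B.card * Ag.card := mul_comm _ _
        omega
      obtain ⟨B', hB', hB'c⟩ := hex
      rw [Finset.mem_powerset] at hB'
      set A1 := Ag.filter (fun a => B'.filter (E a) = I a) with hA1
      obtain ⟨conf, hconf⟩ : ∃ conf : α → α → Prop, ∀ a a', conf a a' ↔ (a ≠ a' ∧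
        1 < (B'.filter (fun b => E a b ∧ E a' b)).card) := ⟨_, fun _ _ => Iff.rfl⟩
      obtain ⟨A', hA', hA'2, hA'3⟩ := greedy_indep conf (by
          intro a a' h
          obtain ⟨h1, h2⟩ := (hconf _ _).1 h
          refine (hconf _ _).2 ⟨h1.symm, ?_⟩
          simpa only [and_comm] using h2) (d * d * M1) A1.card A1 le_rfl (by
        intro a ha
        have ha1 := Finset.mem_filter.1 ha
        have haA : a ∈ A := (Finset.mem_sdiff.1 ha1.1).1
        have hsub : A1.filter (conf a) ⊆ ((I a ×ˢ I a).filter (fun p => p.1 ≠ p.2)).biUnion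
            (fun p => A.filter (fun x => E x p.1 ∧ E x p.2)) := by
          intro x hx
          have hx1 := Finset.mem_filter.1 hx
          obtain ⟨b, hb, b', hb', hbb⟩ := Finset.one_lt_card.1 ((hconf _ _).1 hx1.2).2
          have hb1 := Finset.mem_filter.1 hb
          have hb2 := Finset.mem_filter.1 hb'
          refine Finset.mem_biUnion.2 ⟨(b, b'), Finset.mem_filter.2 ⟨Finset.mem_product.2
            ⟨?_, ?_⟩, hbb⟩, Finset.mem_filter.2 ⟨?_, hb1.2.2, hb2.2.2⟩⟩
          · rw [← ha1.2]
            exact Finset.mem_filter.2 ⟨hb1.1, hb1.2.1⟩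
          · rw [← ha1.2]
            exact Finset.mem_filter.2 ⟨hb2.1, hb2.2.1⟩
          · exact (Finset.mem_sdiff.1 (Finset.mem_filter.1 hx1.1).1).1
        refine (Finset.card_le_card hsub).trans (Finset.card_biUnion_le.trans ?_)
        have hIc : (I a).card ≤ d := (Finset.card_le_card (hI1 a ha1.1)).trans (hdeg a haA).2
        calc _ ≤ ∑ p ∈ (I a ×ˢ I a).filter (fun p => p.1 ≠ p.2), M1 := by
              apply Finset.sum_le_sum
              intro p hp
              have hp1 := Finset.mem_filter.1 hp
              have hp2 := Finset.mem_product.1 hp1.1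
              have := hI3 a ha1.1 p.1 hp2.1 p.2 hp2.2 hp1.2
              rw [hheavy, not_and, not_le] at this
              exact (this hp1.2).le
          _ = ((I a ×ˢ I a).filter (fun p => p.1 ≠ p.2)).card * M1 := by simp
          _ ≤ (I a ×ˢ I a).card * M1 :=
              Nat.mul_le_mul_right _ (Finset.card_le_card (Finset.filter_subset _ _))
          _ ≤ d * d * M1 := by
              rw [Finset.card_product]
              exact Nat.mul_le_mul_right _ (Nat.mul_le_mul hIc hIc))
      have hfin : A.card ≤ (2 * 2 ^ d * (d * d * M1 + 1)) * A'.card := by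
        calc A.card ≤ 2 * Ag.card := hAgc
          _ ≤ 2 * (2 ^ d * A1.card) := Nat.mul_le_mul_left _ hB'c
          _ ≤ 2 * (2 ^ d * (A'.card * (d * d * M1 + 1))) := by gcongr
          _ = _ := by ring
      refine ⟨A', ?_, B', hB', ?_, ?_, ?_, ?_⟩
      · intro x hx
        exact (Finset.mem_sdiff.1 (Finset.mem_filter.1 (hA' hx)).1).1
      · rw [← Finset.card_pos]
        have := Finset.card_pos.2 hA
        by_contra h0
        have h0 : A'.card = 0 := by omega
        rw [h0] at hfin
        omega
      · have h1 := hM.trans hfin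
        exact (Finset.card_le_card hB').trans (Nat.le_of_mul_le_mul_left h1 (by positivity))
      · intro a ha
        have ha1 := Finset.mem_filter.1 (hA' ha)
        rw [ha1.2]
        exact hI2 a ha1.1
      · intro a ha a' ha' hne
        have := hA'2 a ha a' ha' hne
        rw [hconf, not_and, not_lt] at this
        exact this hne

theorem pow_pred_bound (r e J : ℕ) (hr : 2 ≤ r) (hJ : J ≤ e * r) :
    r ^ J ≤ 9 ^ e * (r - 1) ^ J := by
  obtain ⟨m, rfl⟩ : ∃ m, r = m + 1 := ⟨r - 1, by omega⟩
  have hm : 1 ≤ m := by omega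
  simp only [Nat.add_sub_cancel]
  have hm' : (0:ℝ) < m := by exact_mod_cast hm
  have h1 : ((m:ℝ) + 1) ≤ m * Real.exp (1 / m) := by
    have := Real.add_one_le_exp (1 / (m:ℝ))
    calc (m:ℝ) + 1 = m * (1 / m + 1) := by field_simp; ring
      _ ≤ _ := by gcongr
  have h2 : ((m:ℝ) + 1) ^ J ≤ m ^ J * Real.exp (J * (1 / m)) := by
    calc ((m:ℝ) + 1) ^ J ≤ (m * Real.exp (1 / m)) ^ J := by gcongr
      _ = _ := by rw [mul_pow, ← Real.exp_nat_mul]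
  have h3 : (J:ℝ) * (1 / m) ≤ ((2 * e : ℕ) : ℝ) * 1 := by
    rw [mul_one_div, div_le_iff₀ hm']
    have : J ≤ 2 * e * m := by nlinarith
    rw [mul_one]
    exact_mod_cast this
  have h4 : Real.exp (J * (1 / m)) ≤ 9 ^ e := by
    calc Real.exp (J * (1 / m)) ≤ Real.exp (((2 * e : ℕ) : ℝ) * 1) := Real.exp_le_exp.2 h3
      _ = (Real.exp 1 ^ 2) ^ e := by rw [Real.exp_nat_mul, pow_mul]
      _ ≤ 9 ^ e := by
        have h := Real.exp_one_lt_d9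
        have h0 := Real.exp_pos 1
        apply pow_le_pow_left₀ (by positivity)
        nlinarith
  have h5 : (((m + 1) ^ J : ℕ) : ℝ) ≤ ((9 ^ e * m ^ J : ℕ) : ℝ) := by
    push_cast
    calc ((m:ℝ) + 1) ^ J ≤ m ^ J * Real.exp (J * (1 / m)) := h2
      _ ≤ m ^ J * 9 ^ e := by gcongr
      _ = _ := by ring
  exact_mod_cast h5

/-- Colourings of the vertices with `r` colours. -/
def colSp (V : Type) [Fintype V] (r : ℕ) : Finset (V → ℕ) :=
  Fintype.piFinset (fun _ : V => Finset.range r)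

theorem card_colSp (V : Type) [Fintype V] (r : ℕ) : (colSp V r).card = r ^ Fintype.card V := by
  simp [colSp]

theorem card_zero_col (V : Type) [Fintype V] (r : ℕ) (hr : 1 ≤ r) (v : V) :
    r * ((colSp V r).filter (fun f => f v = 0)).card ≤ r ^ Fintype.card V := by
  have h1 : (colSp V r).filter (fun f => f v = 0) ⊆
      Fintype.piFinset (fun u : V => if u = v then {0} else Finset.range r) := by
    intro f hf
    have hf' := Finset.mem_filter.1 hf
    have hf2 := Fintype.mem_piFinset.1 hf'.1
    rw [Fintype.mem_piFinset]
    intro u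
    by_cases h : u = v
    · subst h
      simp [hf'.2]
    · simp only [h, if_false]
      exact hf2 u
  have h2 := Finset.card_le_card h1
  rw [Fintype.card_piFinset] at h2
  have h3 : r * ∏ u : V, (if u = v then ({0} : Finset ℕ) else Finset.range r).card =
      r ^ Fintype.card V := by
    have h4 : r = ∏ u : V, (if u = v then r else 1) := by simp
    conv_lhs => rw [h4]
    rw [← Finset.prod_mul_distrib, ← Finset.card_univ, ← Finset.prod_const]
    apply Finset.prod_congr rfl
    intro u _
    by_cases h : u = v
    · simp only [h, if_true, Finset.card_singleton, mul_one]
    · simp only [h, if_false, Finset.card_range, one_mul]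
      exact h4.symm
  calc _ ≤ _ := Nat.mul_le_mul_left r h2
    _ = _ := h3

theorem card_event (V : Type) [Fintype V] (r e : ℕ) (hr : 2 ≤ r) (I J : Finset V)
    (hIJ : Disjoint I J) (hJ : J.card ≤ e * r) :
    r ^ Fintype.card V ≤ ((colSp V r).filter
      (fun f => (∀ v ∈ I, f v = 0) ∧ ∀ v ∈ J, f v ≠ 0)).card * r ^ I.card * 9 ^ e := by
  set c : V → Finset ℕ := fun v => if v ∈ I then {0} else
    if v ∈ J then (Finset.range r).erase 0 else Finset.range r with hc
  have hsub : Fintype.piFinset c ⊆ (colSp V r).filter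
      (fun f => (∀ v ∈ I, f v = 0) ∧ ∀ v ∈ J, f v ≠ 0) := by
    intro f hf
    rw [Fintype.mem_piFinset] at hf
    refine Finset.mem_filter.2 ⟨Fintype.mem_piFinset.2 ?_, ?_, ?_⟩
    · intro v
      have := hf v
      simp only [hc] at this
      split_ifs at this
      · rw [Finset.mem_singleton] at this
        rw [this, Finset.mem_range]
        omega
      · exact Finset.mem_of_mem_erase this
      · exact this
    · intro v hv
      have := hf v
      simpa [hc, hv] using this
    · intro v hv
      have hvI : v ∉ I := fun h => Finset.disjoint_left.1 hIJ h hv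
      have := hf v
      simp only [hc, hvI, hv, if_true, if_false] at this
      exact Finset.ne_of_mem_erase this
  have hcard := Finset.card_le_card hsub
  rw [Fintype.card_piFinset] at hcard
  have hprod : (∏ v, (c v).card) * r ^ I.card * r ^ J.card =
      r ^ Fintype.card V * (r - 1) ^ J.card := by
    have h1 : r ^ I.card = ∏ v : V, (if v ∈ I then r else 1) := by
      simp [Finset.prod_ite_mem]
    have h2 : r ^ J.card = ∏ v : V, (if v ∈ J then r else 1) := by
      simp [Finset.prod_ite_mem]
    have h3 : (r - 1) ^ J.card = ∏ v : V, (if v ∈ J then r - 1 else 1) := by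
      simp [Finset.prod_ite_mem]
    have h4 : r ^ Fintype.card V = ∏ v : V, r := by simp
    rw [h1, h2, h3, h4, ← Finset.prod_mul_distrib, ← Finset.prod_mul_distrib,
      ← Finset.prod_mul_distrib]
    apply Finset.prod_congr rfl
    intro v _
    by_cases hvI : v ∈ I
    · have hvJ : v ∉ J := fun h => Finset.disjoint_left.1 hIJ hvI h
      simp [hc, hvI, hvJ]
    · by_cases hvJ : v ∈ J
      · have h0 : 0 ∈ Finset.range r := by
          rw [Finset.mem_range]
          omega
        simp only [hc, hvI, hvJ, if_true, if_false, Finset.card_erase_of_mem h0,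
          Finset.card_range]
        ring
      · simp [hc, hvI, hvJ]
  have hpb := pow_pred_bound r e J.card hr hJ
  have hpos : 0 < (r - 1) ^ J.card := Nat.pow_pos (by omega)
  refine Nat.le_of_mul_le_mul_right ?_ hpos
  rw [← hprod]
  calc (∏ v, (c v).card) * r ^ I.card * r ^ J.card
      ≤ (∏ v, (c v).card) * r ^ I.card * (9 ^ e * (r - 1) ^ J.card) := by gcongr
    _ ≤ _ := by
      rw [← mul_assoc]
      gcongr

/-- Supersaturated Ramsey. -/
theorem many_indep {V : Type} (G : SimpleGraph V) (q d0 : ℕ) (X : Finset V) (hX : NoClq G q X)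
    (R : ℕ) (hR : R = (d0 + 1) ^ (q + 1) + 1) (hx : R ≤ X.card) :
    X.card.choose d0 ≤ R.choose d0 * ((X.powersetCard d0).filter (Indep G)).card := by
  have hRd : d0 ≤ R := by
    have : d0 + 1 ≤ (d0 + 1) ^ (q + 1) := Nat.le_self_pow (by omega) _
    omega
  set D := (X.powersetCard d0).filter (Indep G) with hD
  have h1 : ∀ T ∈ X.powersetCard R, 1 ≤ (D.filter (fun I => I ⊆ T)).card := by
    intro T hT
    rw [Finset.mem_powersetCard] at hT
    have : ∃ I ⊆ T, Indep G I ∧ d0 ≤ I.card := by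
      by_contra hcon
      push Not at hcon
      have := ramsey_poly G d0 q T (hX.mono hT.1) (fun I hI hI' => (hcon I hI hI').le)
      omega
    obtain ⟨I, hIT, hI, hIc⟩ := this
    obtain ⟨I', hI', hI'c⟩ := Finset.exists_subset_card_eq hIc
    apply Finset.card_pos.2
    refine ⟨I', Finset.mem_filter.2 ⟨Finset.mem_filter.2 ⟨Finset.mem_powersetCard.2 ⟨?_, hI'c⟩,
      hI.mono hI'⟩, hI'.trans hIT⟩⟩
    exact (hI'.trans hIT).trans hT.1
  have h2 := Finset.sum_le_sum h1
  rw [Finset.sum_const, smul_eq_mul, mul_one, Finset.card_powersetCard] at h2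
  have h3 : ∑ T ∈ X.powersetCard R, (D.filter (fun I => I ⊆ T)).card =
      ∑ I ∈ D, ((X.powersetCard R).filter (fun T => I ⊆ T)).card := by
    simp only [Finset.card_filter _ D, Finset.card_filter _ (X.powersetCard R)]
    rw [Finset.sum_comm]
  have h4 : ∀ I ∈ D, ((X.powersetCard R).filter (fun T => I ⊆ T)).card ≤
      (X.card - d0).choose (R - d0) := by
    intro I hI
    have hI' := Finset.mem_powersetCard.1 (Finset.mem_filter.1 hI).1
    have h5 : ((X \ I).powersetCard (R - d0)).card = (X.card - d0).choose (R - d0) := by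
      rw [Finset.card_powersetCard, Finset.card_sdiff_of_subset hI'.1, hI'.2]
    rw [← h5]
    apply Finset.card_le_card_of_injOn (fun T => T \ I)
    · intro T hT
      have hT' := Finset.mem_filter.1 (Finset.mem_coe.1 hT)
      have hT2 := Finset.mem_powersetCard.1 hT'.1
      refine Finset.mem_coe.2 (Finset.mem_powersetCard.2
        ⟨Finset.sdiff_subset_sdiff hT2.1 le_rfl, ?_⟩)
      rw [Finset.card_sdiff_of_subset hT'.2, hT2.2, hI'.2]
    · intro T hT S hS hTS
      have hT' := (Finset.mem_filter.1 (Finset.mem_coe.1 hT)).2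
      have hS' := (Finset.mem_filter.1 (Finset.mem_coe.1 hS)).2
      simp only at hTS
      rw [← Finset.sdiff_union_of_subset hT', hTS, Finset.sdiff_union_of_subset hS']
  rw [h3] at h2
  have h6 := h2.trans (Finset.sum_le_card_nsmul _ _ _ h4)
  rw [smul_eq_mul] at h6
  have h7 := Nat.choose_mul (n := X.card) (k := R) (s := d0) hRd
  have hpos : 0 < (X.card - d0).choose (R - d0) := Nat.choose_pos (by omega)
  refine Nat.le_of_mul_le_mul_right ?_ hpos
  rw [← h7]
  calc X.card.choose R * R.choose d0
      ≤ (D.card * (X.card - d0).choose (R - d0)) * R.choose d0 := Nat.mul_le_mul_right _ h6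
    _ = _ := by ring

theorem pow_le_choose_const (d0 r : ℕ) (h : 2 * d0 ≤ r) :
    r ^ d0 ≤ 2 ^ d0 * d0.factorial * r.choose d0 := by
  have h1 : (r + 1 - d0) ^ d0 ≤ d0.factorial * r.choose d0 := by
    rw [← Nat.descFactorial_eq_factorial_mul_choose]
    exact Nat.pow_sub_le_descFactorial r d0
  calc r ^ d0 ≤ (2 * (r + 1 - d0)) ^ d0 := Nat.pow_le_pow_left (by omega) _
    _ = 2 ^ d0 * (r + 1 - d0) ^ d0 := mul_pow _ _ _
    _ ≤ 2 ^ d0 * (d0.factorial * r.choose d0) := Nat.mul_le_mul_left _ h1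
    _ = _ := by ring

theorem sampling (q d0 : ℕ) : ∃ κ r0 : ℕ, 0 < κ ∧ ∀ r ≥ r0, ∀ (V : Type) [Fintype V] [Nonempty V]
    (G : SimpleGraph V) (rk : V → ℕ), Function.Injective rk →
    (∀ v, (Finset.univ.filter (fun u => G.Adj v u ∧ rk u < rk v)).card ≤ r) →
    (∀ v, r ≤ (Finset.univ.filter (G.Adj v)).card) → NoClq G q Finset.univ →
    Fintype.card V ≤
      2 * (Finset.univ.filter (fun v => (Finset.univ.filter (G.Adj v)).card ≤ 4 * r)).card →
    ∃ A B : Finset V, Disjoint A B ∧ A.Nonempty ∧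
      (∀ a ∈ A, (Finset.univ.filter (G.Adj a)).card ≤ 4 * r) ∧ Indep G B ∧
      (∀ a ∈ A, (B.filter (G.Adj a)).card = d0) ∧ r * B.card ≤ κ * A.card := by
  set R := (d0 + 1) ^ (q + 1) + 1 with hR
  set e := d0 + 5 with he
  set κ0 := 2 ^ d0 * d0.factorial * R.choose d0 * 9 ^ e with hκ0
  have hRd : d0 ≤ R := by
    have : d0 + 1 ≤ (d0 + 1) ^ (q + 1) := Nat.le_self_pow (by omega) _
    omega
  have hκpos : 0 < κ0 := by
    have h1 : 0 < R.choose d0 := Nat.choose_pos hRd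
    have h2 := d0.factorial_pos
    positivity
  refine ⟨4 * κ0, R + 2 * d0 + 2, by positivity, ?_⟩
  intro r hr V _ _ G rk hrk hout hmin hclq hAcard
  set Ag := Finset.univ.filter (fun v => (Finset.univ.filter (G.Adj v)).card ≤ 4 * r) with hAg
  set Bf : (V → ℕ) → Finset V := fun f => Finset.univ.filter
    (fun v => f v = 0 ∧ ∀ u, G.Adj v u → rk u < rk v → f u ≠ 0) with hBf
  set n := Fintype.card V with hn
  -- the key count
  have hgood : ∀ a ∈ Ag, r ^ n ≤ κ0 * ((colSp V r).filter
      (fun f => f a ≠ 0 ∧ ((Bf f).filter (G.Adj a)).card = d0)).card := by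
    intro a ha
    have ha4 := (Finset.mem_filter.1 ha).2
    set N := Finset.univ.filter (G.Adj a) with hN
    set D := (N.powersetCard d0).filter (Indep G) with hD
    have hDc := many_indep G q d0 N (hclq.mono (Finset.subset_univ _)) R hR
      ((show R ≤ r by omega).trans (hmin a))
    have hch : r.choose d0 ≤ N.card.choose d0 := Nat.choose_le_choose _ (hmin a)
    have hpc := pow_le_choose_const d0 r (by omega)
    set J : Finset V → Finset V := fun I =>
      (N ∪ {a} ∪ I.biUnion (fun v => Finset.univ.filter (fun u => G.Adj v u ∧ rk u < rk v))) \ I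
      with hJ
    set Ev : Finset V → Finset (V → ℕ) := fun I => (colSp V r).filter
      (fun f => (∀ v ∈ I, f v = 0) ∧ ∀ v ∈ J I, f v ≠ 0) with hEv
    have hDmem : ∀ I ∈ D, I ⊆ N ∧ I.card = d0 ∧ Indep G I := by
      intro I hI
      have h1 := Finset.mem_filter.1 hI
      have h2 := Finset.mem_powersetCard.1 h1.1
      exact ⟨h2.1, h2.2, h1.2⟩
    have hEc : ∀ I ∈ D, r ^ n ≤ (Ev I).card * r ^ d0 * 9 ^ e := by
      intro I hI
      obtain ⟨hIN, hIc, hIi⟩ := hDmem I hI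
      have hJc : (J I).card ≤ e * r := by
        have h1 : (J I).card ≤ (N ∪ {a} ∪ I.biUnion
          (fun v => Finset.univ.filter (fun u => G.Adj v u ∧ rk u < rk v))).card :=
          Finset.card_le_card Finset.sdiff_subset
        have h2 := Finset.card_union_le (N ∪ {a}) (I.biUnion
          (fun v => Finset.univ.filter (fun u => G.Adj v u ∧ rk u < rk v)))
        have h3 := Finset.card_union_le N {a}
        have h4 : (I.biUnion (fun v => Finset.univ.filter
            (fun u => G.Adj v u ∧ rk u < rk v))).card ≤ d0 * r := by
          rw [← hIc]
          exact Finset.card_biUnion_le_card_mul _ _ _ (fun v _ => hout v)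
        rw [Finset.card_singleton] at h3
        have h5 : e * r = d0 * r + 5 * r := by rw [he]; ring
        omega
      have := card_event V r e (by omega) I (J I) Finset.disjoint_sdiff hJc
      rwa [hIc] at this
    -- the intersection with the neighbourhood recovers `I`
    have hrec : ∀ I ∈ D, ∀ f ∈ Ev I, N.filter (fun v => f v = 0) = I := by
      intro I hI f hf
      obtain ⟨hIN, hIc, hIi⟩ := hDmem I hI
      have hf' := (Finset.mem_filter.1 hf).2
      ext x
      rw [Finset.mem_filter]
      constructor
      · rintro ⟨hx, hx0⟩
        by_contra hxI
        refine hf'.2 x ?_ hx0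
        simp only [hJ, Finset.mem_sdiff, Finset.mem_union]
        exact ⟨Or.inl (Or.inl hx), hxI⟩
      · intro hx
        exact ⟨hIN hx, hf'.1 x hx⟩
    have hdisj : (D : Set (Finset V)).PairwiseDisjoint Ev := by
      intro I hI I' hI' hne
      rw [Function.onFun, Finset.disjoint_left]
      intro f hf hf'
      exact hne ((hrec I hI f hf).symm.trans (hrec I' hI' f hf'))
    have hsub : D.biUnion Ev ⊆ (colSp V r).filter
        (fun f => f a ≠ 0 ∧ ((Bf f).filter (G.Adj a)).card = d0) := by
      intro f hf
      obtain ⟨I, hI, hfI⟩ := Finset.mem_biUnion.1 hf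
      obtain ⟨hIN, hIc, hIi⟩ := hDmem I hI
      have hf1 := Finset.mem_filter.1 hfI
      refine Finset.mem_filter.2 ⟨hf1.1, ?_, ?_⟩
      · apply hf1.2.2
        simp only [hJ, Finset.mem_sdiff, Finset.mem_union]
        refine ⟨Or.inl (Or.inr (by simp)), fun h => ?_⟩
        have := hIN h
        simp [hN] at this
      · rw [← hIc]
        congr 1
        ext x
        simp only [hBf, Finset.mem_filter, Finset.mem_univ, true_and]
        constructor
        · rintro ⟨⟨hx0, _⟩, hax⟩
          rw [← hrec I hI f hfI, Finset.mem_filter]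
          exact ⟨by simpa [hN] using hax, hx0⟩
        · intro hx
          have hxN := hIN hx
          refine ⟨⟨hf1.2.1 x hx, fun u hu hlt => ?_⟩, by simpa [hN] using hxN⟩
          apply hf1.2.2
          simp only [hJ, Finset.mem_sdiff, Finset.mem_union, Finset.mem_biUnion,
            Finset.mem_filter, Finset.mem_univ, true_and]
          exact ⟨Or.inr ⟨x, hx, hu, hlt⟩, fun huI => hIi x hx u huI hu⟩
    have hcs := Finset.card_le_card hsub
    rw [Finset.card_biUnion hdisj] at hcs
    have hsum := Finset.sum_le_sum hEc
    rw [Finset.sum_const, smul_eq_mul, ← Finset.sum_mul, ← Finset.sum_mul] at hsum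
    have hrpos : 0 < r ^ d0 := Nat.pow_pos (by omega)
    set gd := ((colSp V r).filter
        (fun f => f a ≠ 0 ∧ ((Bf f).filter (G.Adj a)).card = d0)).card with hgd
    refine Nat.le_of_mul_le_mul_left ?_ hrpos
    calc r ^ d0 * r ^ n
        ≤ (2 ^ d0 * d0.factorial * (R.choose d0 * D.card)) * r ^ n := by
          apply Nat.mul_le_mul_right
          exact hpc.trans (Nat.mul_le_mul_left _ (hch.trans hDc))
      _ = (2 ^ d0 * d0.factorial * R.choose d0) * (D.card * r ^ n) := by ring
      _ ≤ (2 ^ d0 * d0.factorial * R.choose d0) * (gd * r ^ d0 * 9 ^ e) := by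
          apply Nat.mul_le_mul_left
          refine hsum.trans ?_
          gcongr
      _ = r ^ d0 * (κ0 * gd) := by rw [hκ0]; ring
  set Af : (V → ℕ) → Finset V := fun f => Ag.filter
    (fun a => f a ≠ 0 ∧ ((Bf f).filter (G.Adj a)).card = d0) with hAf
  have hsumA : Ag.card * r ^ n ≤ κ0 * ∑ f ∈ colSp V r, (Af f).card := by
    have h1 := Finset.sum_le_sum hgood
    rw [Finset.sum_const, smul_eq_mul, ← Finset.mul_sum] at h1
    refine h1.trans (le_of_eq ?_)
    congr 1
    simp only [hAf, Finset.card_filter _ (colSp V r), Finset.card_filter _ Ag]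
    rw [Finset.sum_comm]
  have hsumB : r * ∑ f ∈ colSp V r, (Bf f).card ≤ n * r ^ n := by
    have h1 : ∑ f ∈ colSp V r, (Bf f).card ≤
        ∑ f ∈ colSp V r, (Finset.univ.filter (fun v => f v = 0)).card := by
      apply Finset.sum_le_sum
      intro f _
      apply Finset.card_le_card
      intro v hv
      have := (Finset.mem_filter.1 hv).2
      exact Finset.mem_filter.2 ⟨Finset.mem_univ _, this.1⟩
    have h2 : ∑ f ∈ colSp V r, (Finset.univ.filter (fun v => f v = 0)).card =
        ∑ v : V, ((colSp V r).filter (fun f => f v = 0)).card := by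
      simp only [Finset.card_filter]
      rw [Finset.sum_comm]
    calc r * ∑ f ∈ colSp V r, (Bf f).card
        ≤ r * ∑ v : V, ((colSp V r).filter (fun f => f v = 0)).card :=
          Nat.mul_le_mul_left _ (h1.trans h2.le)
      _ = ∑ v : V, r * ((colSp V r).filter (fun f => f v = 0)).card := Finset.mul_sum _ _ _
      _ ≤ ∑ v : V, r ^ n := Finset.sum_le_sum (fun v _ => card_zero_col V r (by omega) v)
      _ = n * r ^ n := by simp [hn]
  have hnpos : 0 < n := Fintype.card_pos
  have hrn : 0 < r ^ n := Nat.pow_pos (by omega)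
  have hex : ∃ f ∈ colSp V r, r * (Bf f).card < 4 * κ0 * (Af f).card := by
    by_contra hcon
    push Not at hcon
    have h1 := Finset.sum_le_sum hcon
    rw [← Finset.mul_sum, ← Finset.mul_sum] at h1
    have h2 : 4 * (Ag.card * r ^ n) ≤ n * r ^ n := by
      calc 4 * (Ag.card * r ^ n) ≤ 4 * (κ0 * ∑ f ∈ colSp V r, (Af f).card) :=
            Nat.mul_le_mul_left _ hsumA
        _ = 4 * κ0 * ∑ f ∈ colSp V r, (Af f).card := by ring
        _ ≤ _ := h1.trans hsumB
    have h3 : n * r ^ n ≤ 2 * Ag.card * r ^ n := Nat.mul_le_mul_right _ hAcard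
    have h4 : 0 < n * r ^ n := by positivity
    have h5 : 2 * Ag.card * r ^ n = 2 * (Ag.card * r ^ n) := by ring
    omega
  obtain ⟨f, _, hf⟩ := hex
  refine ⟨Af f, Bf f, ?_, ?_, ?_, ?_, ?_, hf.le⟩
  · rw [Finset.disjoint_left]
    intro x hx hx'
    exact (Finset.mem_filter.1 hx).2.1 (Finset.mem_filter.1 hx').2.1
  · rw [Finset.nonempty_iff_ne_empty]
    intro h
    rw [h] at hf
    simp at hf
  · intro a ha
    exact (Finset.mem_filter.1 (Finset.mem_filter.1 ha).1).2
  · intro x hx y hy hxy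
    have hx' := (Finset.mem_filter.1 hx).2
    have hy' := (Finset.mem_filter.1 hy).2
    rcases lt_or_gt_of_ne (fun h => hxy.ne (hrk h) : rk x ≠ rk y) with h | h
    · exact hy'.2 x hxy.symm h hx'.1
    · exact hx'.2 y hxy h hy'.1
  · intro a ha
    exact (Finset.mem_filter.1 ha).2.2

/-- Degenerate graphs have a good vertex ranking. -/
theorem ranking {V : Type} (G : SimpleGraph V) (r : ℕ) : ∀ (n : ℕ) (S : Finset V), S.card ≤ n →
    (∀ T ⊆ S, T.Nonempty → ∃ v ∈ T, (T.filter (G.Adj v)).card ≤ r) →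
    ∃ rk : V → ℕ, Set.InjOn rk S ∧
      ∀ v ∈ S, (S.filter (fun u => G.Adj v u ∧ rk u < rk v)).card ≤ r := by
  intro n
  induction n with
  | zero =>
    intro S hS _
    have : S = ∅ := by simpa using hS
    subst this
    exact ⟨fun _ => 0, by simp, by simp⟩
  | succ n ih =>
    intro S hS hdeg
    rcases S.eq_empty_or_nonempty with rfl | hne
    · exact ⟨fun _ => 0, by simp, by simp⟩
    obtain ⟨v, hv, hvd⟩ := hdeg S le_rfl hne
    have hc := Finset.card_erase_of_mem hv
    obtain ⟨rk, hinj, hrk⟩ := ih (S.erase v) (by omega)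
      (fun T hT => hdeg T (hT.trans (Finset.erase_subset _ _)))
    set m := S.sup rk + 1 with hm
    have hlt : ∀ x ∈ S, rk x < m := fun x hx => Nat.lt_succ_of_le (Finset.le_sup (f := rk) hx)
    refine ⟨fun x => if x = v then m else rk x, ?_, ?_⟩
    · intro x hx y hy hxy
      simp only at hxy
      split_ifs at hxy with h1 h2 h2
      · rw [h1, h2]
      · exact absurd hxy (hlt y hy).ne'
      · exact absurd hxy (hlt x hx).ne
      · exact hinj (by simp [h1]; exact hx) (by simp [h2]; exact hy) hxy
    · intro x hx
      by_cases hxv : x = v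
      · subst hxv
        refine (Finset.card_le_card ?_).trans hvd
        intro u hu
        have := Finset.mem_filter.1 hu
        exact Finset.mem_filter.2 ⟨this.1, this.2.1⟩
      · refine (Finset.card_le_card ?_).trans (hrk x (Finset.mem_erase.2 ⟨hxv, hx⟩))
        intro u hu
        have h := Finset.mem_filter.1 hu
        have h2 := h.2.2
        simp only [hxv, if_false] at h2
        by_cases huv : u = v
        · simp only [huv, if_true] at h2
          exact absurd h2 (hlt x hx).le.not_gt
        · simp only [huv, if_false] at h2
          exact Finset.mem_filter.2 ⟨Finset.mem_erase.2 ⟨huv, h.1⟩, h.2.1, h2⟩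

theorem degree_sum_of_ranking {V : Type} (G : SimpleGraph V) (r : ℕ) (S : Finset V) (rk : V → ℕ)
    (hinj : Set.InjOn rk S)
    (hrk : ∀ v ∈ S, (S.filter (fun u => G.Adj v u ∧ rk u < rk v)).card ≤ r) :
    ∑ v ∈ S, (S.filter (G.Adj v)).card ≤ 2 * (r * S.card) := by
  have h1 : ∀ v ∈ S, (S.filter (G.Adj v)).card ≤
      (S.filter (fun u => G.Adj v u ∧ rk u < rk v)).card +
      (S.filter (fun u => G.Adj v u ∧ rk v < rk u)).card := by
    intro v hv
    refine (Finset.card_le_card ?_).trans (Finset.card_union_le _ _)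
    intro u hu
    have hu' := Finset.mem_filter.1 hu
    rw [Finset.mem_union, Finset.mem_filter, Finset.mem_filter]
    rcases lt_or_gt_of_ne (fun h => hu'.2.ne (hinj hv hu'.1 h) : rk v ≠ rk u) with h | h
    · exact Or.inr ⟨hu'.1, hu'.2, h⟩
    · exact Or.inl ⟨hu'.1, hu'.2, h⟩
  have h2 := Finset.sum_le_sum h1
  rw [Finset.sum_add_distrib] at h2
  have h3 : ∑ v ∈ S, (S.filter (fun u => G.Adj v u ∧ rk v < rk u)).card =
      ∑ v ∈ S, (S.filter (fun u => G.Adj v u ∧ rk u < rk v)).card := by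
    simp only [Finset.card_filter]
    rw [Finset.sum_comm]
    simp only [G.adj_comm]
  have h4 := Finset.sum_le_card_nsmul _ _ _ hrk
  rw [smul_eq_mul] at h4
  rw [h3] at h2
  nlinarith

theorem noClq_of_noBiclique {V : Type} (G : SimpleGraph V) (s : ℕ) (h : ¬ HasBicliqueSub G s)
    (X : Finset V) : NoClq G (2 * s) X := by
  intro Q _ hQ hadj
  obtain ⟨A, hAQ, hA⟩ := Finset.exists_subset_card_eq (s := Q) (n := s) (by omega)
  apply h
  refine ⟨A, Q \ A, Finset.disjoint_sdiff, hA, ?_, ?_⟩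
  · rw [Finset.card_sdiff_of_subset hAQ]; omega
  · intro a ha b hb
    rw [Finset.mem_sdiff] at hb
    exact hadj a (hAQ ha) b hb.1 (fun e => hb.2 (e ▸ ha))

theorem half_small {V : Type} (S : Finset V) (f : V → ℕ) (r : ℕ)
    (h : ∑ v ∈ S, f v ≤ 2 * (r * S.card)) :
    S.card ≤ 2 * (S.filter (fun v => f v ≤ 4 * r)).card := by
  have h1 : (4 * r + 1) * (S.filter (fun v => ¬ f v ≤ 4 * r)).card ≤ ∑ v ∈ S, f v := by
    calc (4 * r + 1) * (S.filter (fun v => ¬ f v ≤ 4 * r)).card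
        = ∑ v ∈ S.filter (fun v => ¬ f v ≤ 4 * r), (4 * r + 1) := by
          rw [Finset.sum_const, smul_eq_mul, mul_comm]
      _ ≤ ∑ v ∈ S.filter (fun v => ¬ f v ≤ 4 * r), f v := by
          apply Finset.sum_le_sum
          intro v hv
          have := (Finset.mem_filter.1 hv).2
          omega
      _ ≤ ∑ v ∈ S, f v := Finset.sum_le_sum_of_subset (Finset.filter_subset _ _)
  have h2 := Finset.card_filter_add_card_filter_not (s := S) (fun v => f v ≤ 4 * r)
  by_contra hc
  push Not at hc
  set x := (S.filter (fun v => ¬ f v ≤ 4 * r)).card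
  have h3 : S.card < 2 * x := by omega
  have h4 : 2 * (r * S.card) ≤ 2 * (r * (2 * x)) := by gcongr
  nlinarith

theorem deg_core (s c : ℕ) : ∃ D : ℕ, ∀ r ≥ D, ∀ (V : Type) [Fintype V] [Nonempty V]
    (G : SimpleGraph V), (∀ v, r ≤ (Finset.univ.filter (G.Adj v)).card) →
    (∀ T : Finset V, T.Nonempty → ∃ v ∈ T, (T.filter (G.Adj v)).card ≤ r) →
    ¬ HasBicliqueSub G s →
    ∃ W P : Finset V, W.Nonempty ∧ (∀ v ∈ W, c < (W.filter (G.Adj v)).card) ∧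
      (∀ a ∈ W, ∀ b ∈ W, G.Adj a b → (a ∈ P ↔ b ∉ P)) ∧
      (∀ a ∈ W, ∀ a' ∈ W, ∀ b ∈ W, ∀ b' ∈ W, a ∈ P → a' ∈ P → a ≠ a' → b ≠ b' →
        G.Adj a b → G.Adj a b' → G.Adj a' b → G.Adj a' b' → False) := by
  obtain ⟨d0, hd0⟩ := unbalanced (2 * c + 1) s s
  obtain ⟨M, hM⟩ := hd0 d0
  obtain ⟨κ, r0, hκ, hsam⟩ := sampling (2 * s) d0
  obtain ⟨Δ0, hΔ⟩ := large_indep (2 * s) (4 * κ * (M + 1))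
  refine ⟨r0 + Δ0 + 1, ?_⟩
  intro r hr V _ _ G hmin hdegen hbi
  have hq := noClq_of_noBiclique G s hbi
  obtain ⟨rk, hinj, hrk⟩ := ranking G r _ Finset.univ le_rfl (fun T _ => hdegen T)
  have hsum := degree_sum_of_ranking G r Finset.univ rk hinj hrk
  have hhalf := half_small _ _ _ hsum
  obtain ⟨A, B, hAB, hAne, hAdeg, hBind, hAd0, hcard⟩ := hsam r (by omega) V G rk
    (fun x y h => hinj (by simp) (by simp) h) (fun v => hrk v (Finset.mem_univ v)) hmin
    (hq _) hhalf
  obtain ⟨I, hIA, hI, hIcard⟩ := hΔ (4 * r) (by omega) V G A (hq A) (by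
    intro v hv
    exact (Finset.card_le_card (Finset.filter_subset_filter _ (Finset.subset_univ A))).trans
      (hAdeg v hv))
  have hApos := hAne.card_pos
  have hIne : I.Nonempty := by
    rw [← Finset.card_pos]
    by_contra h
    have h0 : I.card = 0 := by omega
    rw [h0] at hIcard
    have : 0 < 4 * κ * (M + 1) * A.card := by positivity
    omega
  have hMB : M * B.card ≤ I.card := by
    have h1 : (4 * r) * ((M + 1) * B.card) ≤ (4 * r) * I.card := by
      calc (4 * r) * ((M + 1) * B.card) = 4 * (M + 1) * (r * B.card) := by ring
        _ ≤ 4 * (M + 1) * (κ * A.card) := by gcongr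
        _ = 4 * κ * (M + 1) * A.card := by ring
        _ ≤ _ := hIcard
    have h2 := Nat.le_of_mul_le_mul_left h1 (by omega)
    nlinarith
  obtain ⟨A', hA'I, B', hB'B, hA'ne, hB'A', hk, hC⟩ := hM V V G.Adj I B hIne
    (fun a ha => ⟨(hAd0 a (hIA ha)).ge, (hAd0 a (hIA ha)).le⟩) hMB (by
      intro S hSB hS
      by_contra hcon
      push Not at hcon
      obtain ⟨X, hX, hXc⟩ := Finset.exists_subset_card_eq hcon
      have hX2 : ∀ {a}, a ∈ X → a ∈ I ∧ ∀ b ∈ S, G.Adj a b := by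
        intro a ha
        have := hX ha
        simpa using this
      apply hbi
      refine ⟨X, S, ?_, hXc, hS, fun a ha b hb => (hX2 ha).2 b hb⟩
      exact Finset.disjoint_of_subset_left
        (fun a ha => hIA (hX2 ha).1)
        (Finset.disjoint_of_subset_right hSB hAB))
  have hdis : Disjoint A' B' := Finset.disjoint_of_subset_left (hA'I.trans hIA)
    (Finset.disjoint_of_subset_right hB'B hAB)
  have hbip : ∀ a ∈ A' ∪ B', ∀ b ∈ A' ∪ B', G.Adj a b → (a ∈ A' ↔ b ∉ A') := by
    intro a ha b hb hab
    constructor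
    · intro h h'
      exact hI a (hA'I h) b (hA'I h') hab
    · intro h
      by_contra h'
      have ha' : a ∈ B' := (Finset.mem_union.1 ha).resolve_left h'
      have hb' : b ∈ B' := (Finset.mem_union.1 hb).resolve_left h
      exact hBind a (hB'B ha') b (hB'B hb') hab
  have hW : ∃ W ⊆ A' ∪ B', W.Nonempty ∧ ∀ v ∈ W, c < (W.filter (G.Adj v)).card := by
    by_contra hcon
    push Not at hcon
    obtain ⟨rk2, hinj2, hrk2⟩ := ranking G c _ (A' ∪ B') le_rfl hcon
    have hs2 := degree_sum_of_ranking G c _ rk2 hinj2 hrk2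
    rw [Finset.sum_union hdis, Finset.card_union_of_disjoint hdis] at hs2
    have e1 : (2 * c + 1) * A'.card ≤ ∑ a ∈ A', (B'.filter (G.Adj a)).card := by
      calc (2 * c + 1) * A'.card = ∑ a ∈ A', (2 * c + 1) := by
            rw [Finset.sum_const, smul_eq_mul, mul_comm]
        _ ≤ _ := Finset.sum_le_sum hk
    have e2 : ∑ a ∈ A', (B'.filter (G.Adj a)).card = ∑ b ∈ B', (A'.filter (G.Adj b)).card := by
      have := Finset.sum_card_bipartiteAbove_eq_sum_card_bipartiteBelow (s := A') (t := B') G.Adj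
      unfold Finset.bipartiteAbove Finset.bipartiteBelow at this
      simp only [G.adj_comm] at this ⊢
      convert this using 4
    have e3 : ∑ a ∈ A', (B'.filter (G.Adj a)).card ≤
        ∑ a ∈ A', ((A' ∪ B').filter (G.Adj a)).card :=
      Finset.sum_le_sum (fun a _ => Finset.card_le_card
        (Finset.filter_subset_filter _ Finset.subset_union_right))
    have e4 : ∑ a ∈ B', (A'.filter (G.Adj a)).card ≤
        ∑ a ∈ B', ((A' ∪ B').filter (G.Adj a)).card :=
      Finset.sum_le_sum (fun a _ => Finset.card_le_card
        (Finset.filter_subset_filter _ Finset.subset_union_left))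
    have hA'pos := hA'ne.card_pos
    nlinarith
  obtain ⟨W, hWU, hWne, hWdeg⟩ := hW
  refine ⟨W, A', hWne, hWdeg, fun a ha b hb => hbip a (hWU ha) b (hWU hb), ?_⟩
  intro a ha a' ha' b hb b' hb' haP haP' hne hne' h1 h2 h3 h4
  have hbB : b ∈ B' := (Finset.mem_union.1 (hWU hb)).resolve_left
    ((hbip a (hWU ha) b (hWU hb) h1).1 haP)
  have hbB' : b' ∈ B' := (Finset.mem_union.1 (hWU hb')).resolve_left
    ((hbip a (hWU ha) b' (hWU hb') h2).1 haP)
  have := hC a haP a' haP' hne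
  rw [Finset.card_le_one] at this
  exact hne' (this b (Finset.mem_filter.2 ⟨hbB, h1, h3⟩) b' (Finset.mem_filter.2 ⟨hbB', h2, h4⟩))

theorem degree_eq_filter {V : Type} [Fintype V] (G : SimpleGraph V) (v : V) 
    (inst : Fintype (G.neighborSet v)) :
    @SimpleGraph.degree V G v inst = (Finset.univ.filter (G.Adj v)).card := by
  rw [← SimpleGraph.card_neighborFinset_eq_degree]
  congr 1
  ext u
  simp

theorem minDeg_le {V : Type} [Fintype V] (G : SimpleGraph V) (v : V) :
    minDeg G ≤ (Finset.univ.filter (G.Adj v)).card := by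
  rw [← degree_eq_filter G v inferInstance]
  exact G.minDegree_le_degree v

theorem le_minDeg {V : Type} [Fintype V] [Nonempty V] (G : SimpleGraph V) (k : ℕ)
    (h : ∀ v, k ≤ (Finset.univ.filter (G.Adj v)).card) : k ≤ minDeg G := by
  apply G.le_minDegree_of_forall_le_degree
  intro v
  rw [degree_eq_filter]
  exact h v

theorem bicliqueNum_bdd {V : Type} [Fintype V] (G : SimpleGraph V) :
    BddAbove {t | HasBicliqueSub G t} := by
  refine ⟨Fintype.card V, ?_⟩
  rintro t ⟨A, B, _, hA, _⟩
  rw [← hA]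
  exact Finset.card_le_univ A

/-- Degrees in an induced subgraph. -/
theorem card_filter_induce_univ {V : Type} (G : SimpleGraph V) (S : Finset V)
    (v : (S : Set V)) (inst : Fintype (S : Set V))
    (inst2 : DecidablePred ((G.induce (S : Set V)).Adj v)) :
    ((@Finset.univ _ inst).filter ((G.induce (S : Set V)).Adj v)).card
      = (S.filter (G.Adj v)).card := by
  apply Finset.card_bij (fun (x : (S : Set V)) _ => (x : V))
  · intro x hx
    have := x.2
    simpa using hx
  · intro x _ y _ h
    exact Subtype.ext h
  · intro y hy
    have hy' := Finset.mem_filter.1 hy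
    exact ⟨⟨y, hy'.1⟩, by simpa using hy'.2, rfl⟩

theorem exists_core {V : Type} [Fintype V] [Nonempty V] (G : SimpleGraph V) (k : ℕ)
    (hk : ∀ v, k ≤ (Finset.univ.filter (G.Adj v)).card) :
    ∃ (S : Finset V) (r : ℕ), S.Nonempty ∧ k ≤ r ∧ (∀ v ∈ S, r ≤ (S.filter (G.Adj v)).card) ∧
      ∀ T : Finset V, T.Nonempty → ∃ v ∈ T, (T.filter (G.Adj v)).card ≤ r := by
  set Pr : ℕ → Prop := fun r => ∃ S : Finset V, S.Nonempty ∧ ∀ v ∈ S, r ≤ (S.filter (G.Adj v)).card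
  have hPk : Pr k := ⟨Finset.univ, Finset.univ_nonempty, fun v _ => hk v⟩
  have hbd : ∀ r, Pr r → r ≤ Fintype.card V := by
    rintro r ⟨S, ⟨v, hv⟩, hS⟩
    exact (hS v hv).trans (Finset.card_le_univ _)
  have hkb := hbd k hPk
  obtain ⟨S, hS, hSr⟩ := Nat.findGreatest_spec hkb hPk
  refine ⟨S, _, hS, Nat.le_findGreatest hkb hPk, hSr, ?_⟩
  intro T hT
  by_contra hcon
  push Not at hcon
  have hP : Pr (Nat.findGreatest Pr (Fintype.card V) + 1) := ⟨T, hT, fun v hv => hcon v hv⟩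
  have := Nat.le_findGreatest (hbd _ hP) hP
  omega

theorem hasBiclique_of_induce {V : Type} (G : SimpleGraph V) (S : Set V) (t : ℕ)
    (h : HasBicliqueSub (G.induce S) t) : HasBicliqueSub G t := by
  obtain ⟨A, B, hd, hA, hB, hAB⟩ := h
  refine ⟨A.map (Function.Embedding.subtype _), B.map (Function.Embedding.subtype _), ?_, ?_, ?_, ?_⟩
  · rwa [Finset.disjoint_map]
  · rwa [Finset.card_map]
  · rwa [Finset.card_map]
  · intro a ha b hb
    obtain ⟨x, hx, rfl⟩ := Finset.mem_map.1 ha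
    obtain ⟨y, hy, rfl⟩ := Finset.mem_map.1 hb
    exact hAB x hx y hy

theorem C4_of_biclique {V : Type} (G : SimpleGraph V) (t : ℕ) (ht : 2 ≤ t)
    (h : HasBicliqueSub G t) : ContainsSub C4 G := by
  obtain ⟨A, B, hd, hA, hB, hAB⟩ := h
  obtain ⟨a, ha, a', ha', hne⟩ := Finset.one_lt_card.1 (show 1 < A.card by omega)
  obtain ⟨b, hb, b', hb', hne'⟩ := Finset.one_lt_card.1 (show 1 < B.card by omega)
  have d1 := hAB a ha b hb
  have d2 := hAB a ha b' hb'
  have d3 := hAB a' ha' b hb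
  have d4 := hAB a' ha' b' hb'
  refine ⟨![a, b, a', b'], ?_, ?_⟩
  · intro i j hij
    have := d1.ne
    have := d2.ne
    have := d3.ne
    have := d4.ne
    fin_cases i <;> fin_cases j <;> simp at hij ⊢ <;> grind
  · intro i j hij
    have d1' := d1.symm
    have d2' := d2.symm
    have d3' := d3.symm
    have d4' := d4.symm
    fin_cases i <;> fin_cases j <;> simp [C4] at hij ⊢ <;> assumption

/-- **Main theorem** -/
theorem degBounded_iff_bipartite_C4free_bounded (F : GraphClass) (hF : Hereditary F) :
    (∃ f : ℕ → ℕ, ∀ (V : Type) [Fintype V] (G : SimpleGraph V),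
        F V G → minDeg G ≤ f (bicliqueNum G)) ↔
    (∃ c : ℕ, ∀ (V : Type) [Fintype V] (H : SimpleGraph V),
        F V H → Bip H → ¬ ContainsSub C4 H → minDeg H ≤ c) := by
  constructor
  · rintro ⟨f, hf⟩
    refine ⟨f 0 + f 1, ?_⟩
    intro V _ H hH _ hC
    have h1 := hf V H hH
    have h2 : bicliqueNum H ≤ 1 := by
      apply csSup_le'
      intro t ht
      by_contra h
      exact hC (C4_of_biclique H t (by omega) ht)
    have h3 : bicliqueNum H = 0 ∨ bicliqueNum H = 1 := by omega
    rcases h3 with h3 | h3 <;> rw [h3] at h1 <;> omega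
  · rintro ⟨c, hc⟩
    choose D hD using fun s => deg_core s c
    refine ⟨fun t => D (t + 1), ?_⟩
    intro V _ G hG
    by_contra hcon
    push Not at hcon
    have hV : Nonempty V := by
      by_contra hne
      rw [not_nonempty_iff] at hne
      have : minDeg G = 0 := by
        unfold minDeg
        simp [SimpleGraph.minDegree]
      omega
    have hnb : ¬ HasBicliqueSub G (bicliqueNum G + 1) := by
      intro h
      have := le_csSup (bicliqueNum_bdd G) h
      have h2 : bicliqueNum G + 1 ≤ bicliqueNum G := this
      omega
    obtain ⟨S, r, hSne, hkr, hSdeg, hTdeg⟩ := exists_core G _ (minDeg_le G)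
    have hFS : F (S : Set V) (G.induce (S : Set V)) := by
      convert hF.2 V G (S : Set V) (by simpa using hSne) hG
    have : Nonempty (S : Set V) := by
      obtain ⟨x, hx⟩ := hSne
      exact ⟨⟨x, hx⟩⟩
    obtain ⟨W, P, hWne, hWdeg, hWP, hWC⟩ := hD (bicliqueNum G + 1) r (by omega) (S : Set V)
      (G.induce (S : Set V))
      (by
        intro v
        rw [card_filter_induce_univ]
        exact hSdeg v v.2)
      (by
        intro T hT
        obtain ⟨v, hv, hvr⟩ := hTdeg (T.map (Function.Embedding.subtype _)) (by simpa using hT)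
        obtain ⟨x, hx, rfl⟩ := Finset.mem_map.1 hv
        refine ⟨x, hx, le_trans (le_of_eq ?_) hvr⟩
        rw [Finset.filter_map, Finset.card_map]
        rfl)
      (fun h => hnb (hasBiclique_of_induce G _ _ h))
    have hFW : F (W : Set (S : Set V)) ((G.induce (S : Set V)).induce (W : Set (S : Set V))) := by
      convert hF.2 _ _ (W : Set (S : Set V)) (by simpa using hWne) hFS
    have : Nonempty (W : Set (S : Set V)) := by
      obtain ⟨x, hx⟩ := hWne
      exact ⟨⟨x, hx⟩⟩
    have hle := @hc _ _ _ hFW ⟨{x | (x : (S : Set V)) ∈ P}, fun a b hab => hWP a a.2 b b.2 hab⟩ (by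
      rintro ⟨g, hg, hgadj⟩
      have a01 : (G.induce (S : Set V)).Adj (g 0) (g 1) := hgadj (by simp [C4])
      have a12 : (G.induce (S : Set V)).Adj (g 1) (g 2) := hgadj (by simp [C4])
      have a23 : (G.induce (S : Set V)).Adj (g 2) (g 3) := hgadj (by simp [C4])
      have a30 : (G.induce (S : Set V)).Adj (g 3) (g 0) := hgadj (by simp [C4])
      have n02 : (g 0 : (S : Set V)) ≠ g 2 := fun h => absurd (hg (Subtype.ext h)) (by decide)
      have n13 : (g 1 : (S : Set V)) ≠ g 3 := fun h => absurd (hg (Subtype.ext h)) (by decide)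
      have m := fun i => (g i).2
      have p01 := hWP _ (m 0) _ (m 1) a01
      have p12 := hWP _ (m 1) _ (m 2) a12
      have p23 := hWP _ (m 2) _ (m 3) a23
      by_cases h0 : (g 0 : (S : Set V)) ∈ P
      · exact hWC _ (m 0) _ (m 2) _ (m 1) _ (m 3) h0 (by tauto) n02 n13 a01 a30.symm a12.symm a23
      · exact hWC _ (m 1) _ (m 3) _ (m 0) _ (m 2) (by tauto) (by tauto) n13 n02
          a01.symm a12 a30 a23.symm)
    refine absurd hle (not_le.2 (@le_minDeg _ _ _ _ (c + 1) ?_))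
    intro v
    rw [card_filter_induce_univ (G.induce (S : Set V)) W v]
    exact hWdeg v v.2
end
end

section
/- For every positive integer t and every natural number n, every finite simple graph on n vertices that has no (not necessarily induced) subgraph isomorphic to the complete bipartite graph K_{t,t} has at most n^(2 − 1/t) + t·n edges (an inequality of real numbers). -/
open SimpleGraph
open scoped Classical

noncomputable section

/-- Double counting of stars. -/
lemma sum_choose_le (t : ℕ) (ht : 0 < t) (n : ℕ) (G : SimpleGraph (Fin n))
    (h : ¬ HasBicliqueSub G t) :
    ∑ v, (G.degree v).choose t ≤ n.choose t * t := by
  have h1 := Finset.sum_card_bipartiteAbove_eq_sum_card_bipartiteBelow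
    (s := (Finset.univ : Finset (Fin n))) (t := Finset.powersetCard t (Finset.univ : Finset (Fin n)))
    (fun v A => A ⊆ G.neighborFinset v)
  have h2 : ∀ v, (Finset.bipartiteAbove (fun v A => A ⊆ G.neighborFinset v)
      (Finset.powersetCard t (Finset.univ : Finset (Fin n))) v).card = (G.degree v).choose t := by
    intro v
    rw [← G.card_neighborFinset_eq_degree v, ← Finset.card_powersetCard]
    congr 1
    ext A
    simp [Finset.bipartiteAbove, Finset.mem_powersetCard, and_comm]
  simp only [h2] at h1
  rw [h1]
  have h3 := Finset.sum_le_card_nsmul (Finset.powersetCard t (Finset.univ : Finset (Fin n)))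
    (fun A => (Finset.bipartiteBelow (fun v A => A ⊆ G.neighborFinset v)
      (Finset.univ : Finset (Fin n)) A).card) t ?_
  · simpa using h3
  · intro A hA
    by_contra hlt
    push Not at hlt
    obtain ⟨B, hB, hBc⟩ := Finset.exists_subset_card_eq hlt.le
    have key : ∀ a ∈ A, ∀ b ∈ B, G.Adj a b := by
      intro a ha b hb
      have := hB hb
      simp only [Finset.bipartiteBelow, Finset.mem_filter] at this
      have := this.2 ha
      rw [SimpleGraph.mem_neighborFinset] at this
      exact this.symm
    refine h ⟨A, B, ?_, (Finset.mem_powersetCard.1 hA).2, hBc, key⟩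
    rw [Finset.disjoint_left]
    intro a ha hb
    exact G.loopless.irrefl a (key a ha a hb)

lemma sum_pow_le (t : ℕ) (ht : 0 < t) (n : ℕ) (G : SimpleGraph (Fin n))
    (h : ¬ HasBicliqueSub G t) :
    ∑ v, (G.degree v + 1 - t) ^ t ≤ n ^ t * t := by
  calc ∑ v, (G.degree v + 1 - t) ^ t ≤ ∑ v, t.factorial * (G.degree v).choose t := by
        apply Finset.sum_le_sum
        intro v _
        rw [← Nat.descFactorial_eq_factorial_mul_choose]
        exact Nat.pow_sub_le_descFactorial _ _
    _ = t.factorial * ∑ v, (G.degree v).choose t := by rw [Finset.mul_sum]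
    _ ≤ t.factorial * (n.choose t * t) := Nat.mul_le_mul_left _ (sum_choose_le t ht n G h)
    _ = n.descFactorial t * t := by rw [Nat.descFactorial_eq_factorial_mul_choose, mul_assoc]
    _ ≤ n ^ t * t := Nat.mul_le_mul_right _ (Nat.descFactorial_le_pow _ _)

lemma real_bound (t : ℕ) (ht : 0 < t) (n : ℕ) (x : Fin n → ℕ)
    (h : ∑ v, x v ^ t ≤ n ^ t * t) :
    (∑ v, (x v : ℝ)) ≤ 2 * (n : ℝ) ^ ((2 : ℝ) - 1 / (t : ℝ)) := by
  rcases Nat.eq_zero_or_pos n with rfl | hn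
  · simp only [Finset.univ_eq_empty, Finset.sum_empty]
    positivity
  have hn' : (0 : ℝ) < n := by exact_mod_cast hn
  have ht' : (t : ℝ) ≠ 0 := by exact_mod_cast ht.ne'
  apply le_of_pow_le_pow_left₀ ht.ne' (by positivity)
  have e : ((n : ℝ) ^ ((2 : ℝ) - 1 / (t : ℝ))) ^ t = (n : ℝ) ^ (t - 1) * (n : ℝ) ^ t := by
    rw [← Real.rpow_natCast, ← Real.rpow_mul hn'.le, ← pow_add, ← Real.rpow_natCast]
    congr 1
    rw [Nat.cast_add, Nat.cast_sub ht]
    field_simp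
    push_cast
    ring
  rw [mul_pow, e]
  obtain ⟨k, rfl⟩ : ∃ k, t = k + 1 := ⟨t - 1, by omega⟩
  have p := pow_sum_div_card_le_sum_pow (s := (Finset.univ : Finset (Fin n)))
    (f := fun v => (x v : ℝ)) (n := k) (fun _ _ => by positivity)
  rw [div_le_iff₀ (by simp; positivity)] at p
  have h' : (∑ v, (x v : ℝ) ^ (k + 1)) ≤ (n : ℝ) ^ (k + 1) * ((k + 1 : ℕ) : ℝ) := by
    exact_mod_cast h
  have h2 : ((k + 1 : ℕ) : ℝ) ≤ 2 ^ (k + 1) := by exact_mod_cast (Nat.lt_two_pow_self).le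
  simp only [Finset.card_univ, Fintype.card_fin] at p
  calc _ ≤ _ := p
    _ ≤ ((n : ℝ) ^ (k + 1) * 2 ^ (k + 1)) * (n : ℝ) ^ k := by
        gcongr
        exact h'.trans (by gcongr)
    _ = _ := by simp only [Nat.add_sub_cancel]; ring

/-- Kővári–Sós–Turán: a `K_{t,t}`-free graph on `n` vertices has at most
`n^(2 - 1/t) + t n` edges. -/
theorem kovari_sos_turan (t : ℕ) (ht : 0 < t) (n : ℕ) (G : SimpleGraph (Fin n))
    (h : ¬ HasBicliqueSub G t) :
    (G.edgeFinset.card : ℝ) ≤ (n : ℝ) ^ ((2 : ℝ) - 1 / (t : ℝ)) + (t : ℝ) * (n : ℝ) := by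
  have hb := real_bound t ht n (fun v => G.degree v + 1 - t) (sum_pow_le t ht n G h)
  have hd : (∑ v, (G.degree v : ℝ)) = 2 * (G.edgeFinset.card : ℝ) := by
    exact_mod_cast G.sum_degrees_eq_twice_card_edges
  have hs : (∑ v, (G.degree v : ℝ)) ≤ ∑ v, (((G.degree v + 1 - t : ℕ) : ℝ) + t) := by
    apply Finset.sum_le_sum
    intro v _
    have : G.degree v ≤ (G.degree v + 1 - t) + t := by omega
    exact_mod_cast this
  rw [Finset.sum_add_distrib] at hs
  simp only [Finset.sum_const, Finset.card_univ, Fintype.card_fin, nsmul_eq_mul] at hs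
  have : (0 : ℝ) ≤ t * n := by positivity
  nlinarith
end
end

section
/- For every finite bipartite graph H there exist a polynomial p_H with nonnegative real coefficients and a real number ε_H > 0 such that for every positive integer t and every natural number n, every finite simple graph on n vertices that has no induced subgraph isomorphic to H and no (not necessarily induced) subgraph isomorphic to K_{t,t} has at most p_H(t) · n^(2 − ε_H) edges. -/
open SimpleGraph
open scoped Classical

noncomputable section

/-- The vertices of `N` different from and not adjacent to `w`. -/
def nonN {V : Type} (G : SimpleGraph V) (w : V) (N : Finset V) : Finset V :=
  N.filter (fun v => ¬ G.Adj w v ∧ v ≠ w)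

/-- Vertices with few non-neighbours in the large set `N`. -/
def badS {V : Type} [Fintype V] (G : SimpleGraph V) (t : ℕ) (N : Finset V) : Finset V :=
  Finset.univ.filter (fun w => 4 * t ≤ N.card ∧ 2 * t * (nonN G w N).card < N.card)

theorem badS_card {V : Type} [Fintype V] (G : SimpleGraph V) (t : ℕ)
    (h : ¬ HasBicliqueSub G t) (N : Finset V) : (badS G t N).card ≤ t := by
  by_contra hc
  push Not at hc
  obtain ⟨C, hCs, hCc⟩ := Finset.exists_subset_card_eq hc.le
  have ht : 0 < t ∨ t = 0 := by omega
  rcases ht with ht | ht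
  swap
  · subst ht
    exact h ⟨∅, ∅, by simp⟩
  have hC : ∀ w ∈ C, 4 * t ≤ N.card ∧ 2 * t * (nonN G w N).card < N.card := by
    intro w hw
    have := hCs hw
    simpa [badS] using this
  have hne : C.Nonempty := by
    rw [← Finset.card_pos]; omega
  obtain ⟨w0, hw0⟩ := hne
  have h4 := (hC w0 hw0).1
  have hsum : 2 * t * ∑ w ∈ C, (nonN G w N).card ≤ t * N.card := by
    rw [Finset.mul_sum]
    calc _ ≤ ∑ w ∈ C, N.card := Finset.sum_le_sum (fun w hw => (hC w hw).2.le)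
      _ = t * N.card := by simp [hCc]
  have hsum2 : 2 * ∑ w ∈ C, (nonN G w N).card ≤ N.card := by
    apply Nat.le_of_mul_le_mul_left _ ht
    linarith
  have hbu : (C.biUnion (fun w => nonN G w N)).card ≤ ∑ w ∈ C, (nonN G w N).card :=
    Finset.card_biUnion_le
  have hun : (C ∪ C.biUnion (fun w => nonN G w N)).card ≤ t + (C.biUnion (fun w => nonN G w N)).card := by
    rw [← hCc]; exact Finset.card_union_le _ _
  have hR : t ≤ (N \ (C ∪ C.biUnion (fun w => nonN G w N))).card := by
    have := Finset.le_card_sdiff (C ∪ C.biUnion (fun w => nonN G w N)) N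
    omega
  obtain ⟨B, hBs, hBc⟩ := Finset.exists_subset_card_eq hR
  refine h ⟨C, B, ?_, hCc, hBc, ?_⟩
  · rw [Finset.disjoint_left]
    intro a ha hb
    have := hBs hb
    simp [ha] at this
  · intro a ha b hb
    have := hBs hb
    simp only [Finset.mem_sdiff, Finset.mem_union, Finset.mem_biUnion, not_or, not_exists,
      not_and, nonN, Finset.mem_filter, not_not] at this
    by_contra hab
    exact this.2.1 ((this.2.2 a ha this.1 hab) ▸ ha)

theorem good_of_not_badS {V : Type} [Fintype V] (G : SimpleGraph V) (t : ℕ) (N : Finset V) (w : V)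
    (hw : w ∉ badS G t N) (hN : 4 * t ≤ N.card) : N.card ≤ 2 * t * (nonN G w N).card := by
  by_contra hc
  exact hw (by simp [badS, hN]; omega)

/-- Many independent transversals. -/
theorem transversals {V : Type} [Fintype V] (G : SimpleGraph V) (t : ℕ) (ht : 0 < t)
    (h : ¬ HasBicliqueSub G t) : ∀ (k : ℕ) (L : ℕ), (k + 4) * t ≤ L → ∀ B : Fin k → Finset V,
    (∀ i, (2 * t) ^ k * L ≤ (B i).card) →
    ∃ F : Finset (Fin k → V), L ^ k ≤ F.card ∧ ∀ f ∈ F, (∀ i, f i ∈ B i) ∧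
      ∀ i j, i ≠ j → ¬ G.Adj (f i) (f j) ∧ f i ≠ f j := by
  intro k
  induction k with
  | zero =>
    intro L hL B hB
    exact ⟨Finset.univ, by simp, fun f _ => ⟨fun i => i.elim0, fun i => i.elim0⟩⟩
  | succ k ih =>
    intro L hL B hB
    have hpow : 1 ≤ (2 * t) ^ k := Nat.one_le_pow _ _ (by omega)
    have hL4 : 4 * t ≤ L := by nlinarith
    have hLk : (k + 4) * t ≤ L := by nlinarith
    have hBL : ∀ i, 2 * L ≤ (B i).card := by
      intro i
      refine le_trans ?_ (hB i)
      apply Nat.mul_le_mul_right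
      rw [pow_succ]
      nlinarith
    set good : Finset V := B 0 \ Finset.univ.biUnion (fun j : Fin k => badS G t (B j.succ)) with hgood
    have hgc : L ≤ good.card := by
      have h1 : (Finset.univ.biUnion (fun j : Fin k => badS G t (B j.succ))).card ≤ k * t := by
        refine Finset.card_biUnion_le.trans ?_
        refine (Finset.sum_le_sum (fun j _ => badS_card G t h (B j.succ))).trans ?_
        simp
      have h2 := Finset.le_card_sdiff (Finset.univ.biUnion (fun j : Fin k => badS G t (B j.succ))) (B 0)
      have h3 := hBL 0
      have h4 : k * t ≤ L := by nlinarith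
      rw [← hgood] at h2
      omega
    have hstep : ∀ y : V, ∃ F : Finset (Fin k → V), y ∈ good → (L ^ k ≤ F.card ∧ ∀ f ∈ F,
        (∀ i, f i ∈ nonN G y (B i.succ)) ∧
        ∀ i j, i ≠ j → ¬ G.Adj (f i) (f j) ∧ f i ≠ f j) := by
      intro y
      by_cases hy : y ∈ good
      · obtain ⟨F, hF⟩ := ih L hLk (fun i => nonN G y (B i.succ)) (by
          intro i
          have hnb : y ∉ badS G t (B i.succ) := by
            intro hb
            rw [hgood, Finset.mem_sdiff] at hy
            exact hy.2 (Finset.mem_biUnion.2 ⟨i, Finset.mem_univ _, hb⟩)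
          have h1 := good_of_not_badS G t _ y hnb (by have := hBL i.succ; omega)
          have h2 := (hB i.succ).trans h1
          refine Nat.le_of_mul_le_mul_left (show 2 * t * _ ≤ 2 * t * _ from ?_) (by omega)
          refine le_trans (le_of_eq ?_) h2
          ring)
        exact ⟨F, fun _ => hF⟩
      · exact ⟨∅, fun h => absurd h hy⟩
    choose F hF using hstep
    refine ⟨(good.sigma F).image (fun p => Fin.cons p.1 p.2), ?_, ?_⟩
    · rw [Finset.card_image_of_injective, Finset.card_sigma]
      · calc L ^ (k + 1) = L * L ^ k := by ring
          _ ≤ good.card * L ^ k := Nat.mul_le_mul_right _ hgc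
          _ = ∑ y ∈ good, L ^ k := by simp
          _ ≤ _ := Finset.sum_le_sum (fun y hy => (hF y hy).1)
      · rintro ⟨a, f⟩ ⟨b, g⟩ hab
        have := Fin.cons_inj.1 hab
        obtain ⟨rfl, rfl⟩ := this
        rfl
    · intro f hf
      simp only [Finset.mem_image, Finset.mem_sigma] at hf
      obtain ⟨⟨y, g⟩, ⟨hy, hg⟩, rfl⟩ := hf
      obtain ⟨h1, h2⟩ := (hF y hy).2 g hg
      simp only [nonN, Finset.mem_filter] at h1
      constructor
      · intro i
        refine Fin.cases ?_ (fun i => ?_) i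
        · simpa using (Finset.mem_sdiff.1 hy).1
        · simpa using (h1 i).1
      · intro i j
        refine Fin.cases ?_ (fun i => ?_) i
        · refine Fin.cases ?_ (fun j => ?_) j
          · simp
          · intro _
            simpa using ⟨(h1 j).2.1, (h1 j).2.2.symm⟩
        · refine Fin.cases ?_ (fun j => ?_) j
          · intro _
            simpa [G.adj_comm] using (h1 i).2
          · intro hij
            simpa using h2 i j (fun h => hij (by rw [h]))

/-- partially prescribed neighbourhood -/
def AS {V : Type} [Fintype V] (G : SimpleGraph V) {k : ℕ} (S : Finset (Fin k)) (r : ℕ)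
    (x : Fin k → V) : Finset V :=
  Finset.univ.filter (fun v => ∀ i, (i ∈ S → G.Adj (x i) v) ∧
    (i ∉ S → i.val < r → ¬ G.Adj (x i) v ∧ v ≠ x i))

theorem count_bad {V : Type} [Fintype V] {k : ℕ} (j : Fin k) (t : ℕ) (g : (Fin k → V) → Finset V)
    (hg : ∀ x y, (∀ i, i ≠ j → x i = y i) → g x = g y) (hc : ∀ x, (g x).card ≤ t) :
    (Finset.univ.filter (fun x : Fin k → V => x j ∈ g x)).card * Fintype.card V
      ≤ t * Fintype.card V ^ k := by
  calc _ = ((Finset.univ.filter (fun x : Fin k → V => x j ∈ g x)) ×ˢ (Finset.univ : Finset V)).card := by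
        simp [Finset.card_product]
    _ ≤ ((Finset.univ : Finset (Fin k → V)).sigma g).card := by
        refine Finset.card_le_card_of_injOn
          (fun p => ⟨Function.update p.1 j p.2, p.1 j⟩) ?_ ?_
        · rintro ⟨x, a⟩ hx
          simp only [Finset.coe_product, Set.mem_prod, Finset.mem_coe, Finset.mem_filter] at hx
          simp only [Finset.mem_coe, Finset.mem_sigma, Finset.mem_univ, true_and]
          rw [hg _ x]
          · exact hx.1.2
          · intro i hi
            simp [hi]
        · rintro ⟨x, a⟩ _ ⟨y, b⟩ _ hxy
          simp only [Sigma.mk.injEq, heq_eq_eq] at hxy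
          obtain ⟨h1, h2⟩ := hxy
          have ha : a = b := by simpa using congrFun h1 j
          have hx : x = y := by
            funext i
            by_cases hi : i = j
            · subst hi; exact h2
            · simpa [hi] using congrFun h1 i
          rw [ha, hx]
    _ ≤ _ := by
        rw [Finset.card_sigma]
        refine (Finset.sum_le_sum (fun x _ => hc x)).trans ?_
        simp [mul_comm]

/-- the tuples which are bad for `S` at `j` -/
def BT {V : Type} [Fintype V] (G : SimpleGraph V) (t k : ℕ) : Finset (Fin k → V) :=
  (Finset.univ : Finset (Finset (Fin k) × Fin k)).biUnion (fun p =>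
    Finset.univ.filter (fun x : Fin k → V => p.2 ∉ p.1 ∧ x p.2 ∈ badS G t (AS G p.1 p.2.val x)))

theorem BT_card {V : Type} [Fintype V] (G : SimpleGraph V) (t k : ℕ)
    (h : ¬ HasBicliqueSub G t) :
    (BT G t k).card * Fintype.card V ≤ 2 ^ k * k * t * Fintype.card V ^ k := by
  calc _ ≤ (∑ p : Finset (Fin k) × Fin k, (Finset.univ.filter (fun x : Fin k → V => p.2 ∉ p.1 ∧ x p.2 ∈ badS G t (AS G p.1 p.2.val x))).card) * Fintype.card V :=
        Nat.mul_le_mul_right _ Finset.card_biUnion_le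
    _ = ∑ p : Finset (Fin k) × Fin k, (Finset.univ.filter (fun x : Fin k → V => p.2 ∉ p.1 ∧ x p.2 ∈ badS G t (AS G p.1 p.2.val x))).card * Fintype.card V := by
        rw [Finset.sum_mul]
    _ ≤ ∑ p : Finset (Fin k) × Fin k, t * Fintype.card V ^ k := by
        refine Finset.sum_le_sum (fun p _ => ?_)
        by_cases hp : p.2 ∈ p.1
        · simp [hp]
        · simp only [hp, not_false_eq_true, true_and]
          apply count_bad p.2 t (fun x => badS G t (AS G p.1 p.2.val x))
          · intro x y hxy
            have : AS G p.1 p.2.val x = AS G p.1 p.2.val y := by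
              ext v
              simp only [AS, Finset.mem_filter, Finset.mem_univ, true_and]
              refine forall_congr' (fun i => ?_)
              by_cases hi : i = p.2
              · subst hi; simp [hp]
              · rw [hxy i hi]
            simp only [this]
          · intro x; exact badS_card G t h _
    _ = _ := by simp; ring

theorem AS_large {V : Type} [Fintype V] (G : SimpleGraph V) (t k M : ℕ) (x : Fin k → V)
    (hM : 4 * t ≤ M) (ht : 0 < t)
    (hx : x ∉ BT G t k) (hN : (2 * t) ^ k * M ≤ (AS G Finset.univ 0 x).card)
    (S : Finset (Fin k)) : M ≤ (AS G S k x).card := by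
  have key : ∀ r, r ≤ k → (2 * t) ^ (k - r) * M ≤ (AS G S r x).card := by
    intro r
    induction r with
    | zero =>
      intro _
      refine hN.trans (Finset.card_le_card ?_)
      intro v hv
      simp only [AS, Finset.mem_filter, Finset.mem_univ, true_and] at hv ⊢
      intro i
      exact ⟨fun _ => (hv i).1 trivial, fun _ h => absurd h (by omega)⟩
    | succ r ih =>
      intro hr
      have h1 := ih (by omega)
      have e : k - r = (k - (r + 1)) + 1 := by omega
      rw [e, pow_succ] at h1
      have hpow : 1 ≤ (2 * t) ^ (k - (r + 1)) := Nat.one_le_pow _ _ (by omega)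
      set j : Fin k := ⟨r, by omega⟩ with hj
      by_cases hS : j ∈ S
      · have : AS G S (r + 1) x = AS G S r x := by
          ext v
          simp only [AS, Finset.mem_filter, Finset.mem_univ, true_and]
          refine forall_congr' (fun i => ?_)
          by_cases hi : i = j
          · subst hi; simp [hS]
          · have : i.val ≠ r := fun h => hi (Fin.ext h)
            have : (i.val < r + 1) ↔ i.val < r := by omega
            rw [this]
        rw [this]
        refine le_trans ?_ h1
        nlinarith [Nat.mul_le_mul hpow hM]
      · have hnb : x j ∉ badS G t (AS G S r x) := by
          intro hb
          apply hx
          simp only [BT, Finset.mem_biUnion, Finset.mem_univ, true_and, Finset.mem_filter]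
          exact ⟨(S, j), hS, hb⟩
        have h4 : 4 * t ≤ (AS G S r x).card := by
          refine le_trans ?_ h1
          calc 4 * t ≤ M := hM
            _ = 1 * 1 * M := by ring
            _ ≤ _ := Nat.mul_le_mul_right _ (Nat.mul_le_mul hpow (by omega))
        have h2 := good_of_not_badS G t _ _ hnb h4
        have h3 : nonN G (x j) (AS G S r x) ⊆ AS G S (r + 1) x := by
          intro v hv
          simp only [nonN, AS, Finset.mem_filter, Finset.mem_univ, true_and] at hv ⊢
          intro i
          refine ⟨(hv.1 i).1, fun hi hir => ?_⟩
          by_cases hij : i = j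
          · rw [hij]; exact hv.2
          · have : i.val ≠ r := fun h => hij (Fin.ext h)
            exact (hv.1 i).2 hi (by omega)
        refine le_trans ?_ (Finset.card_le_card h3)
        refine Nat.le_of_mul_le_mul_left (show 2 * t * _ ≤ 2 * t * _ from ?_) (by omega)
        refine le_trans (le_of_eq ?_) (h1.trans h2)
        ring
  simpa using key k le_rfl

/-- A good tuple yields an induced copy. -/
theorem embed {V : Type} [Fintype V] (G : SimpleGraph V) (t k : ℕ) (ht : 0 < t)
    (h : ¬ HasBicliqueSub G t) (H : SimpleGraph (Fin k)) (hH : Bip H)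
    (x : Fin k → V) (hx : x ∉ BT G t k)
    (hi : ∀ i j, i ≠ j → ¬ G.Adj (x i) (x j) ∧ x i ≠ x j)
    (hN : (2 * t) ^ k * ((2 * t) ^ k * ((k + 4) * t)) ≤ (AS G Finset.univ 0 x).card) :
    Nonempty (H ↪g G) := by
  obtain ⟨A, hA⟩ := hH
  have hpow : 1 ≤ (2 * t) ^ k := Nat.one_le_pow _ _ (by omega)
  have hM : 4 * t ≤ (2 * t) ^ k * ((k + 4) * t) := by
    calc 4 * t = 1 * (4 * t) := by ring
      _ ≤ _ := Nat.mul_le_mul hpow (Nat.mul_le_mul_right _ (by omega))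
  obtain ⟨F, hF, hF2⟩ := transversals G t ht h k ((k + 4) * t) le_rfl
    (fun w => AS G (Finset.univ.filter (fun i => H.Adj i w)) k x)
    (fun w => AS_large G t k _ x hM ht hx hN _)
  have hpos : 0 < F.card := lt_of_lt_of_le (pow_pos (by positivity) _) hF
  obtain ⟨y, hy⟩ := Finset.card_pos.1 hpos
  obtain ⟨hy1, hy2⟩ := hF2 y hy
  simp only [AS, Finset.mem_filter, Finset.mem_univ, true_and, Fin.is_lt, true_imp_iff] at hy1
  -- cross relation
  have hadj : ∀ i j, G.Adj (x i) (y j) ↔ H.Adj i j := by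
    intro i j
    by_cases hij : H.Adj i j
    · simp [hij, (hy1 j i).1 hij]
    · simp [hij, ((hy1 j i).2 hij).1]
  have hne : ∀ i j, x i ≠ y j := by
    intro i j
    by_cases hij : H.Adj i j
    · exact ((hy1 j i).1 hij).ne
    · exact ((hy1 j i).2 hij).2.symm
  refine ⟨⟨⟨fun w => if w ∈ A then x w else y w, ?_⟩, ?_⟩⟩
  · intro a b hab
    by_contra hn
    by_cases ha : a ∈ A <;> by_cases hb : b ∈ A <;> simp only [ha, hb, if_true, if_false] at hab
    · exact (hi a b hn).2 hab
    · exact hne _ _ hab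
    · exact hne _ _ hab.symm
    · exact (hy2 a b hn).2 hab
  · intro a b
    change G.Adj (if a ∈ A then x a else y a) (if b ∈ A then x b else y b) ↔ H.Adj a b
    by_cases hn : a = b
    · subst hn; simp
    by_cases ha : a ∈ A <;> by_cases hb : b ∈ A <;> simp only [ha, hb, if_true, if_false]
    · have : ¬ H.Adj a b := fun hh => ((hA hh).1 ha) hb
      simp [this, (hi a b hn).1]
    · exact hadj a b
    · rw [G.adj_comm, H.adj_comm]; exact hadj b a
    · have : ¬ H.Adj a b := fun hh => ha ((hA hh).2 hb)
      simp [this, (hy2 a b hn).1]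

/-- The main counting inequality. -/
theorem main_count {V : Type} [Fintype V] (G : SimpleGraph V) (t k L : ℕ) (ht : 0 < t)
    (h : ¬ HasBicliqueSub G t) (H : SimpleGraph (Fin k)) (hH : Bip H)
    (hind : IsEmpty (H ↪g G)) (hL : (k + 4) * t ≤ L) :
    (Finset.univ.filter (fun v => (2 * t) ^ k * L ≤ G.degree v)).card * L ^ k ≤
      (2 ^ k * k * t + (2 * t) ^ k * ((2 * t) ^ k * ((k + 4) * t))) * Fintype.card V ^ k := by
  set I : Finset (Fin k → V) := Finset.univ.filter
    (fun x => ∀ i j, i ≠ j → ¬ G.Adj (x i) (x j) ∧ x i ≠ x j) with hI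
  set m := (2 * t) ^ k * ((2 * t) ^ k * ((k + 4) * t)) with hm
  calc _ = ∑ v ∈ (Finset.univ.filter (fun v => (2 * t) ^ k * L ≤ G.degree v)), L ^ k := by simp
    _ ≤ ∑ v ∈ (Finset.univ.filter (fun v => (2 * t) ^ k * L ≤ G.degree v)),
        (I.filter (fun x => ∀ i, G.Adj (x i) v)).card := by
      refine Finset.sum_le_sum (fun v hv => ?_)
      simp only [Finset.mem_filter, Finset.mem_univ, true_and] at hv
      obtain ⟨F, hF, hF2⟩ := transversals G t ht h k L hL (fun _ => G.neighborFinset v)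
        (fun _ => by rw [G.card_neighborFinset_eq_degree]; exact hv)
      refine hF.trans (Finset.card_le_card ?_)
      intro f hf
      have := hF2 f hf
      simp only [hI, Finset.mem_filter, Finset.mem_univ, true_and]
      exact ⟨this.2, fun i => by simpa [G.adj_comm] using this.1 i⟩
    _ ≤ ∑ v, (I.filter (fun x => ∀ i, G.Adj (x i) v)).card :=
      Finset.sum_le_sum_of_subset (Finset.subset_univ _)
    _ = ∑ x ∈ I, (AS G Finset.univ 0 x).card := by
      simp only [AS, Finset.card_filter, Finset.mem_univ, true_imp_iff, not_true_eq_false,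
        false_imp_iff, and_true]
      rw [Finset.sum_comm]
    _ ≤ ∑ x ∈ I, ((if x ∈ BT G t k then Fintype.card V else 0) + m) := by
      refine Finset.sum_le_sum (fun x hx => ?_)
      split_ifs with hb
      · exact (Finset.card_le_univ _).trans (Nat.le_add_right _ _)
      · rw [zero_add]
        by_contra hc
        simp only [hI, Finset.mem_filter, Finset.mem_univ, true_and] at hx
        obtain ⟨e⟩ := embed G t k ht h H hH x hb hx (by omega)
        exact hind.false e
    _ ≤ ∑ x, ((if x ∈ BT G t k then Fintype.card V else 0) + m) :=
      Finset.sum_le_sum_of_subset (Finset.subset_univ _)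
    _ = (BT G t k).card * Fintype.card V + m * Fintype.card V ^ k := by
      rw [Finset.sum_add_distrib]
      simp [mul_comm]
    _ ≤ _ := by
      rw [add_mul]
      exact Nat.add_le_add_right (BT_card G t k h) _

theorem edges_le_of_big {V : Type} [Fintype V] (G : SimpleGraph V) (D : ℕ) (d : ℝ)
    (hD : (D : ℝ) ≤ d) (hd : d * Fintype.card V = G.edgeFinset.card) (hn : 0 < Fintype.card V) :
    d ≤ ((Finset.univ.filter (fun v => D ≤ G.degree v)).card : ℝ) := by
  set n := Fintype.card V
  set big := Finset.univ.filter (fun v => D ≤ G.degree v)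
  have h1 : ∑ v, G.degree v ≤ ∑ v, ((if v ∈ big then n else 0) + D) := by
    refine Finset.sum_le_sum (fun v _ => ?_)
    split_ifs with hb
    · have := G.degree_lt_card_verts v
      omega
    · simp [big] at hb
      omega
  rw [G.sum_degrees_eq_twice_card_edges, Finset.sum_add_distrib] at h1
  simp at h1
  have h2 : (2 : ℝ) * G.edgeFinset.card ≤ big.card * n + n * D := by
    have : 2 * G.edgeFinset.card ≤ big.card * n + n * D := by simpa using h1
    exact_mod_cast this
  have hn' : (0 : ℝ) < n := by exact_mod_cast hn
  rw [← hd] at h2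
  have : d * n ≤ big.card * n := by nlinarith
  exact le_of_mul_le_mul_right this hn'

theorem final_bound (k t n : ℕ) (ht : 0 < t) (hn : 0 < n) (G : SimpleGraph (Fin n))
    (h : ¬ HasBicliqueSub G t) (H : SimpleGraph (Fin k)) (hH : Bip H)
    (hind : IsEmpty (H ↪g G)) :
    (G.edgeFinset.card : ℝ) ≤ ((4 ^ k * (2 * k + 4) * 2 ^ (k + k ^ 2) : ℕ) : ℝ) *
      (t : ℝ) ^ ((k + 1) ^ 2) * (n : ℝ) ^ ((2 : ℝ) - 1 / ((k : ℝ) + 1)) := by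
  set c : ℝ := ((4 ^ k * (2 * k + 4) * 2 ^ (k + k ^ 2) : ℕ) : ℝ) with hc
  have hn1 : (1 : ℝ) ≤ n := by exact_mod_cast hn
  have hn0 : (0 : ℝ) < n := by linarith
  have ht1 : (1 : ℝ) ≤ t := by exact_mod_cast ht
  set d : ℝ := G.edgeFinset.card / n with hd
  have hd0 : 0 ≤ d := by positivity
  set R : ℝ := c * (t : ℝ) ^ ((k + 1) ^ 2) with hR
  have hc1 : 1 ≤ c := by
    rw [hc]
    have : 0 < 4 ^ k * (2 * k + 4) * 2 ^ (k + k ^ 2) := by positivity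
    exact_mod_cast this
  have hR1 : 1 ≤ R := by
    have := one_le_pow₀ ht1 (n := (k + 1) ^ 2)
    nlinarith
  have hk1 : (0 : ℝ) < (k : ℝ) + 1 := by positivity
  -- suffices a bound for d
  suffices hs : d ≤ R * (n : ℝ) ^ ((k : ℝ) / (k + 1)) by
    have e1 : (2 : ℝ) - 1 / ((k : ℝ) + 1) = (k : ℝ) / (k + 1) + 1 := by field_simp; ring
    rw [e1, Real.rpow_add hn0, Real.rpow_one, ← mul_assoc]
    rwa [hd, div_le_iff₀ hn0] at hs
  have hnp : (1 : ℝ) ≤ (n : ℝ) ^ ((k : ℝ) / (k + 1)) := Real.one_le_rpow hn1 (by positivity)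
  have hq : (0 : ℝ) < (2 * t) ^ k := by positivity
  by_cases hsm : d ≤ (2 * t) ^ k * ((k + 4) * t)
  · have h1 : ((2 : ℝ) * t) ^ k * ((k + 4) * t) ≤ R := by
      have e : ((2 : ℝ) * t) ^ k * ((k + 4) * t) = (2 ^ k * (k + 4)) * t ^ (k + 1) := by ring
      rw [e, hR]
      apply mul_le_mul _ _ (by positivity) (by positivity)
      · rw [hc]; push_cast
        have a1 : (2 : ℝ) ^ k ≤ 4 ^ k := by gcongr; norm_num
        have a2 : (k : ℝ) + 4 ≤ 2 * k + 4 := by have : (0 : ℝ) ≤ k := by positivity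
                                                linarith
        have a3 : (1 : ℝ) ≤ 2 ^ (k + k ^ 2) := one_le_pow₀ (by norm_num)
        calc (2 : ℝ) ^ k * (k + 4) ≤ 4 ^ k * (2 * k + 4) := by gcongr
          _ ≤ _ := le_mul_of_one_le_right (by positivity) a3
      · exact pow_le_pow_right₀ ht1 (by nlinarith)
    nlinarith
  · push Not at hsm
    set L : ℕ := ⌊d / (2 * t) ^ k⌋₊ with hL
    have hLle : (L : ℝ) ≤ d / (2 * t) ^ k := Nat.floor_le (by positivity)
    have hkl : (k + 4) * t ≤ L := by
      apply Nat.le_floor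
      push_cast
      rw [le_div_iff₀ hq]
      linarith
    have hL1 : (1 : ℝ) ≤ L := by
      have : 1 ≤ L := le_trans (by nlinarith) hkl
      exact_mod_cast this
    have hL2 : d / (2 * t) ^ k ≤ 2 * L := by
      have := Nat.lt_floor_add_one (d / (2 * (t : ℝ)) ^ k)
      rw [← hL] at this
      linarith
    have hbig := edges_le_of_big G ((2 * t) ^ k * L) d (by
      push_cast
      rw [le_div_iff₀ hq] at hLle
      linarith) (by rw [hd]; simp; field_simp) (by simpa using hn)
    have hm := main_count G t k L ht h H hH hind hkl
    rw [Fintype.card_fin] at hm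
    have hm' : ((Finset.univ.filter (fun v => (2 * t) ^ k * L ≤ G.degree v)).card : ℝ) * L ^ k ≤
      (2 ^ k * k * t + (2 * t) ^ k * ((2 * t) ^ k * ((k + 4) * t))) * (n : ℝ) ^ k := by
      exact_mod_cast hm
    have hP : (2 : ℝ) ^ k * k * t + (2 * t) ^ k * ((2 * t) ^ k * ((k + 4) * t)) ≤
        4 ^ k * (2 * k + 4) * t ^ (2 * k + 1) := by
      have e : (2 * (t : ℝ)) ^ k * ((2 * t) ^ k * ((k + 4) * t)) =
          4 ^ k * (k + 4) * t ^ (2 * k + 1) := by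
        rw [show (4 : ℝ) = 2 * 2 by norm_num, mul_pow, mul_pow]; ring
      have a1 : (2 : ℝ) ^ k ≤ 4 ^ k := by gcongr; norm_num
      have a2 : (t : ℝ) ≤ t ^ (2 * k + 1) := le_self_pow₀ ht1 (by omega)
      have a3 : (2 : ℝ) ^ k * k * t ≤ 4 ^ k * k * t ^ (2 * k + 1) := by gcongr
      rw [e]
      calc _ ≤ 4 ^ k * k * (t : ℝ) ^ (2 * k + 1) + 4 ^ k * (k + 4) * t ^ (2 * k + 1) := by linarith
        _ = _ := by ring
    have hdk : d ^ (k + 1) ≤ R * (n : ℝ) ^ k := by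
      have b1 : d ≤ 2 * (2 * t) ^ k * L := by
        rw [div_le_iff₀ hq] at hL2; linarith
      calc d ^ (k + 1) = d * d ^ k := by ring
        _ ≤ d * (2 * (2 * t) ^ k * L) ^ k := by gcongr
        _ = (2 * (2 * t) ^ k) ^ k * (d * L ^ k) := by ring
        _ ≤ (2 * (2 * t) ^ k) ^ k * ((4 ^ k * (2 * k + 4) * t ^ (2 * k + 1)) * (n : ℝ) ^ k) := by
          refine mul_le_mul_of_nonneg_left ?_ (by positivity)
          refine le_trans (mul_le_mul_of_nonneg_right hbig (by positivity)) (hm'.trans ?_)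
          gcongr
        _ = R * (n : ℝ) ^ k := by
          rw [hR, hc]; push_cast
          have : (2 * (2 * (t : ℝ)) ^ k) ^ k = 2 ^ (k + k ^ 2) * t ^ (k ^ 2) := by
            rw [mul_pow, ← pow_mul, mul_pow, pow_add, sq]; ring
          rw [this]; ring
    refine le_of_pow_le_pow_left₀ (n := k + 1) (by omega) (by positivity) ?_
    rw [mul_pow]
    have e2 : ((n : ℝ) ^ ((k : ℝ) / (k + 1))) ^ (k + 1) = (n : ℝ) ^ k := by
      rw [← Real.rpow_natCast, ← Real.rpow_mul hn0.le]
      push_cast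
      rw [div_mul_cancel₀ _ hk1.ne', Real.rpow_natCast]
    rw [e2]
    refine hdk.trans ?_
    gcongr
    exact le_self_pow₀ hR1 (by omega)

/-- Strengthening of Kővári–Sós–Turán for graphs omitting a fixed bipartite graph `H`
as an induced subgraph. -/
theorem stronger_kst (W : Type) [Fintype W] (H : SimpleGraph W) (hH : Bip H) :
    ∃ (p : Polynomial ℝ) (ε : ℝ), (∀ i : ℕ, 0 ≤ p.coeff i) ∧ 0 < ε ∧
      ∀ t : ℕ, 0 < t → ∀ (n : ℕ) (G : SimpleGraph (Fin n)),
        (¬ ∃ s : Set (Fin n), Nonempty (G.induce s ≃g H)) →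
        ¬ HasBicliqueSub G t →
        (G.edgeFinset.card : ℝ) ≤ p.eval (t : ℝ) * (n : ℝ) ^ ((2 : ℝ) - ε) := by
  set k := Fintype.card W with hk
  let e : W ≃ Fin k := Fintype.equivFin W
  let H' : SimpleGraph (Fin k) := H.comap e.symm
  let iso : H' ≃g H := ⟨e.symm, Iff.rfl⟩
  have hH' : Bip H' := by
    obtain ⟨A, hA⟩ := hH
    exact ⟨e.symm ⁻¹' A, fun a b hab => hA hab⟩
  refine ⟨Polynomial.C ((4 ^ k * (2 * k + 4) * 2 ^ (k + k ^ 2) : ℕ) : ℝ) *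
    Polynomial.X ^ ((k + 1) ^ 2), 1 / ((k : ℝ) + 1), ?_, by positivity, ?_⟩
  · intro i
    rw [Polynomial.coeff_C_mul_X_pow]
    split_ifs
    · positivity
    · exact le_rfl
  · intro t ht n G hG hK
    have hind : IsEmpty (H' ↪g G) := by
      refine ⟨fun f => hG ⟨Set.range f, ⟨?_⟩⟩⟩
      have g : H' ≃g G.induce (Set.range f) :=
        ⟨Equiv.ofInjective f f.injective, by intro a b; simp⟩
      exact g.symm.trans iso
    rw [Polynomial.eval_mul, Polynomial.eval_C, Polynomial.eval_pow, Polynomial.eval_X]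
    rcases Nat.eq_zero_or_pos n with rfl | hn
    · have : G.edgeFinset.card = 0 := by
        have : G = ⊥ := Subsingleton.elim _ _
        subst this
        simp
      rw [this]
      simp only [Nat.cast_zero]
      positivity
    · exact final_bound k t n ht hn G hK H' hH' hind
end
end
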